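/- (Extrapolation on mixed Lebesgue spaces.) Let 0 < q_0 < ∞ and q⃗ = (q_1,…,q_n) ∈ (0,∞)^n with q_0 < q_j for all j = 1,…,n. Let 𝔉 be a family of ordered pairs (f,g) of nonnegative measurable functions on ℝ^n, and suppose there is a nondecreasing function N : [1,∞) → (0,∞) such that for every A_1 weight w and every (f,g) ∈ 𝔉, ∫_{ℝ^n} f(x)^{q_0} w(x) dx ≤ N([w]_{A_1}) ∫_{ℝ^n} g(x)^{q_0} w(x) dx. Then there is a constant C > 0 such that ‖f‖_{L^{q⃗}} ≤ C ‖g‖_{L^{q⃗}} for all pairs (f,g) ∈ 𝔉 with ‖f‖_{L^{q⃗}} < ∞. -/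

import Mathlib

open MeasureTheory ENNReal Set

noncomputable section

/-- Euclidean distance on `Fin n → ℝ`. -/
def eudist (n : ℕ) (x y : Fin n → ℝ) : ℝ :=
  Real.sqrt (∑ i, (x i - y i) ^ 2)

/-- Open Euclidean ball in `Fin n → ℝ`. -/
def eball (n : ℕ) (x : Fin n → ℝ) (r : ℝ) : Set (Fin n → ℝ) :=
  {y | eudist n x y < r}

/-- Iterated mixed Lebesgue "norm" of an `ℝ≥0∞`-valued function: the innermost
integration is in the first coordinate with exponent `q 0`, the outermost in the
last coordinate with exponent `q (n-1)`. -/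
def mixedLnorm : (n : ℕ) → (Fin n → ℝ) → ((Fin n → ℝ) → ℝ≥0∞) → ℝ≥0∞
  | 0, _, g => g (fun i => i.elim0)
  | (n + 1), q, g =>
      (∫⁻ t : ℝ, (mixedLnorm n (fun i => q i.castSucc)
          (fun y => g (Fin.snoc y t))) ^ q (Fin.last n)) ^ (1 / q (Fin.last n))

/-- Mixed Lebesgue norm `‖f‖_{L^{q⃗}}` of a real-valued function on `ℝ^n`. -/
def mixedNorm (n : ℕ) (q : Fin n → ℝ) (f : (Fin n → ℝ) → ℝ) : ℝ≥0∞ :=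
  mixedLnorm n q (fun x => ENNReal.ofReal |f x|)

/-- Generalized mixed Morrey norm of an `ℝ≥0∞`-valued function. -/
def morreyLnorm (n : ℕ) (q : Fin n → ℝ) (φ : (Fin n → ℝ) → ℝ → ℝ)
    (g : (Fin n → ℝ) → ℝ≥0∞) : ℝ≥0∞ :=
  ⨆ (x : Fin n → ℝ) (r : ℝ) (_ : 0 < r),
    (ENNReal.ofReal (φ x r))⁻¹
      * (mixedNorm n q ((eball n x r).indicator fun _ => (1 : ℝ)))⁻¹
      * mixedLnorm n q ((eball n x r).indicator g)

/-- Generalized mixed Morrey norm `‖f‖_{M^φ_{q⃗}}` of a real-valued function. -/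
def morreyNorm (n : ℕ) (q : Fin n → ℝ) (φ : (Fin n → ℝ) → ℝ → ℝ)
    (f : (Fin n → ℝ) → ℝ) : ℝ≥0∞ :=
  morreyLnorm n q φ (fun x => ENNReal.ofReal |f x|)

/-- The BMO norm (as an extended real number). -/
def bmoNorm (n : ℕ) (b : (Fin n → ℝ) → ℝ) : ℝ≥0∞ :=
  ⨆ (x : Fin n → ℝ) (r : ℝ) (_ : 0 < r),
    ENNReal.ofReal ((volume (eball n x r)).toReal⁻¹
      * ∫ y in eball n x r, |b y - ⨍ z in eball n x r, b z|)

/-- Sublinearity in each entry of a multi-(sub)linear operator. -/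
def EntrywiseSublinear (n m : ℕ)
    (T : (Fin m → ((Fin n → ℝ) → ℝ)) → ((Fin n → ℝ) → ℝ)) : Prop :=
  (∀ (f : Fin m → ((Fin n → ℝ) → ℝ)) (i : Fin m) (g h : (Fin n → ℝ) → ℝ)
      (x : Fin n → ℝ),
      |T (Function.update f i (g + h)) x|
        ≤ |T (Function.update f i g) x| + |T (Function.update f i h) x|) ∧
  (∀ (f : Fin m → ((Fin n → ℝ) → ℝ)) (i : Fin m) (c : ℝ) (g : (Fin n → ℝ) → ℝ)
      (x : Fin n → ℝ),
      |T (Function.update f i (c • g)) x| = |c| * |T (Function.update f i g) x|)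

/-- The multi-sublinear size condition (1.1) with constant `C`. -/
def SizeCond (n m : ℕ)
    (T : (Fin m → ((Fin n → ℝ) → ℝ)) → ((Fin n → ℝ) → ℝ)) (C : ℝ) : Prop :=
  ∀ f : Fin m → ((Fin n → ℝ) → ℝ),
    (∀ i, Integrable (f i)) → (∀ i, HasCompactSupport (f i)) →
    ∀ x, x ∉ ⋂ j, Function.support (f j) →
      |T f x| ≤ C * ∫ y : Fin m → (Fin n → ℝ),
        (∏ i, |f i (y i)|) / Real.sqrt (∑ i, eudist n x (y i) ^ 2) ^ (m * n)

/-- The multi-sublinear commutator size condition (1.2), with symbol `b` and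
distinguished index `i`, with constant `C`. -/
def CommSizeCond (n m : ℕ) (b : (Fin n → ℝ) → ℝ) (i : Fin m)
    (T : (Fin m → ((Fin n → ℝ) → ℝ)) → ((Fin n → ℝ) → ℝ)) (C : ℝ) : Prop :=
  ∀ f : Fin m → ((Fin n → ℝ) → ℝ),
    (∀ k, Integrable (f k)) → (∀ k, HasCompactSupport (f k)) →
    ∀ x, x ∉ ⋂ j, Function.support (f j) →
      |T f x| ≤ C * ∫ y : Fin m → (Fin n → ℝ),
        |b x - b (y i)| * (∏ k, |f k (y k)|)
          / Real.sqrt (∑ k, eudist n x (y k) ^ 2) ^ (m * n)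

/-- The Hardy–Littlewood maximal operator. -/
def hlMax (n : ℕ) (f : (Fin n → ℝ) → ℝ) (x : Fin n → ℝ) : ℝ≥0∞ :=
  ⨆ (r : ℝ) (_ : 0 < r),
    (volume (eball n x r))⁻¹ * ∫⁻ y in eball n x r, ENNReal.ofReal |f y|

/-- The maximal commutator of the Hardy–Littlewood maximal operator. -/
def maxComm (n : ℕ) (b f : (Fin n → ℝ) → ℝ) (x : Fin n → ℝ) : ℝ≥0∞ :=
  ⨆ (r : ℝ) (_ : 0 < r),
    (volume (eball n x r))⁻¹
      * ∫⁻ y in eball n x r, ENNReal.ofReal (|b x - b y| * |f y|)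

/-- The multi-sublinear maximal operator `M_m`. -/
def multiMax (n m : ℕ) (f : Fin m → ((Fin n → ℝ) → ℝ)) (x : Fin n → ℝ) : ℝ≥0∞ :=
  ⨆ (r : ℝ) (_ : 0 < r),
    ∏ i, (volume (eball n x r))⁻¹ * ∫⁻ y in eball n x r, ENNReal.ofReal |f i y|

/-- The multi-sublinear maximal commutator `M^{b⃗}_{m,i}`. -/
def multiMaxComm (n m : ℕ) (b : Fin m → ((Fin n → ℝ) → ℝ)) (i : Fin m)
    (f : Fin m → ((Fin n → ℝ) → ℝ)) (x : Fin n → ℝ) : ℝ≥0∞ :=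
  (⨆ (r : ℝ) (_ : 0 < r),
      (volume (eball n x r))⁻¹
        * ∫⁻ y in eball n x r, ENNReal.ofReal (|b i x - b i y| * |f i y|)) *
  (⨆ (r : ℝ) (_ : 0 < r),
      ∏ k ∈ Finset.univ.erase i,
        (volume (eball n x r))⁻¹ * ∫⁻ y in eball n x r, ENNReal.ofReal |f k y|)

/-- `w` is an `A₁` weight with constant `c`. -/
def IsA1Weight (n : ℕ) (w : (Fin n → ℝ) → ℝ) (c : ℝ) : Prop :=
  (∀ x, 0 < w x) ∧ LocallyIntegrable w ∧
    ∀ (x : Fin n → ℝ) (r : ℝ), 0 < r →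
      ∀ᵐ y ∂(volume.restrict (eball n x r)),
        (volume (eball n x r)).toReal⁻¹ * ∫ z in eball n x r, w z ≤ c * w y

/-- `T` is an `m`-linear Calderón–Zygmund operator. -/
def IsCZOperator (n m : ℕ)
    (T : (Fin m → ((Fin n → ℝ) → ℝ)) → ((Fin n → ℝ) → ℝ)) : Prop :=
  -- additivity in each entry
  (∀ (f : Fin m → ((Fin n → ℝ) → ℝ)) (i : Fin m) (g h : (Fin n → ℝ) → ℝ),
      T (Function.update f i (g + h))
        = T (Function.update f i g) + T (Function.update f i h)) ∧
  -- homogeneity in each entry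
  (∀ (f : Fin m → ((Fin n → ℝ) → ℝ)) (i : Fin m) (c : ℝ) (g : (Fin n → ℝ) → ℝ),
      T (Function.update f i (c • g)) = c • T (Function.update f i g)) ∧
  -- boundedness from a product of Lebesgue spaces
  (∃ (s : Fin m → ℝ) (s₀ A : ℝ), (∀ i, 1 ≤ s i) ∧ 0 < s₀ ∧
      (1 / s₀ = ∑ i, 1 / s i) ∧ 0 < A ∧
      ∀ f : Fin m → ((Fin n → ℝ) → ℝ), (∀ i, Measurable (f i)) →
        (∀ i, mixedNorm n (fun _ => s i) (f i) ≠ ⊤) →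
        mixedNorm n (fun _ => s₀) (T f)
          ≤ ENNReal.ofReal A * ∏ i, mixedNorm n (fun _ => s i) (f i)) ∧
  -- Calderón–Zygmund kernel and representation
  (∃ (K : (Fin n → ℝ) → (Fin m → (Fin n → ℝ)) → ℝ) (ε C : ℝ), 0 < ε ∧ 0 < C ∧
      -- size estimate
      (∀ x y, ¬(∀ k, y k = x) →
        |K x y| ≤ C / (∑ k, eudist n x (y k)) ^ (m * n)) ∧
      -- regularity in the first variable
      (∀ x x' y, ¬(∀ k, y k = x) →
        2 * eudist n x x' ≤ (⨆ k, eudist n x (y k)) →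
        |K x y - K x' y|
          ≤ C * eudist n x x' ^ ε / (∑ k, eudist n x (y k)) ^ ((m * n : ℝ) + ε)) ∧
      -- regularity in each of the remaining variables
      (∀ x y (k : Fin m) (y' : Fin n → ℝ), ¬(∀ j, y j = x) →
        2 * eudist n (y k) y' ≤ (⨆ j, eudist n x (y j)) →
        |K x y - K x (Function.update y k y')|
          ≤ C * eudist n (y k) y' ^ ε / (∑ j, eudist n x (y j)) ^ ((m * n : ℝ) + ε)) ∧
      -- integral representation off the supports
      (∀ f : Fin m → ((Fin n → ℝ) → ℝ),
        (∀ j, Measurable (f j)) → (∀ j, ∃ M : ℝ, ∀ x, |f j x| ≤ M) →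
        (∀ j, HasCompactSupport (f j)) →
        ∀ x, x ∉ ⋂ j, Function.support (f j) →
          T f x = ∫ y : Fin m → (Fin n → ℝ), K x y * ∏ j, f j (y j)))

/-- The commutator `K^{b⃗}_{m,i}` of an `m`-linear operator. -/
def czComm (n m : ℕ) (T : (Fin m → ((Fin n → ℝ) → ℝ)) → ((Fin n → ℝ) → ℝ))
    (b : Fin m → ((Fin n → ℝ) → ℝ)) (i : Fin m)
    (f : Fin m → ((Fin n → ℝ) → ℝ)) : (Fin n → ℝ) → ℝ :=
  fun x => b i x * T f x - T (Function.update f i fun y => b i y * f i y) x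

/-- Uncentered maximal function w.r.t. a measure, over open sup-norm balls (cubes). -/
def mxf {d : ℕ} (μ : Measure (Fin d → ℝ)) (f : (Fin d → ℝ) → ℝ≥0∞) (x : Fin d → ℝ) : ℝ≥0∞ :=
  ⨆ p : (Fin d → ℝ) × ℝ, (Metric.ball p.1 p.2).indicator
    (fun _ => (∫⁻ y in Metric.ball p.1 p.2, f y ∂μ) / μ (Metric.ball p.1 p.2)) x

lemma mxf_measurable {d : ℕ} (μ : Measure (Fin d → ℝ)) (f : (Fin d → ℝ) → ℝ≥0∞) :
    Measurable (mxf μ f) := by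
  refine LowerSemicontinuous.measurable ?_
  exact lowerSemicontinuous_iSup fun p =>
    Metric.isOpen_ball.lowerSemicontinuous_indicator (zero_le)

lemma le_mxf {d : ℕ} (μ : Measure (Fin d → ℝ)) (f : (Fin d → ℝ) → ℝ≥0∞) {x c : Fin d → ℝ}
    {r : ℝ} (hx : x ∈ Metric.ball c r) :
    (∫⁻ y in Metric.ball c r, f y ∂μ) / μ (Metric.ball c r) ≤ mxf μ f x := by
  refine le_trans ?_ (le_iSup _ (c, r))
  rw [indicator_of_mem hx]

lemma mxf_le {d : ℕ} (μ : Measure (Fin d → ℝ)) (f : (Fin d → ℝ) → ℝ≥0∞) {x : Fin d → ℝ}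
    {a : ℝ≥0∞} (h : ∀ c r, x ∈ Metric.ball c r →
      (∫⁻ y in Metric.ball c r, f y ∂μ) / μ (Metric.ball c r) ≤ a) : mxf μ f x ≤ a := by
  refine iSup_le fun p => ?_
  by_cases hx : x ∈ Metric.ball p.1 p.2
  · rw [indicator_of_mem hx]; exact h _ _ hx
  · rw [indicator_of_notMem hx]; exact zero_le

lemma lt_mxf {d : ℕ} (μ : Measure (Fin d → ℝ)) (f : (Fin d → ℝ) → ℝ≥0∞) {x : Fin d → ℝ}
    {a : ℝ≥0∞} (h : a < mxf μ f x) : ∃ c r, x ∈ Metric.ball c r ∧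
      a < (∫⁻ y in Metric.ball c r, f y ∂μ) / μ (Metric.ball c r) := by
  by_contra! hc
  exact absurd (mxf_le μ f hc) (not_le.2 h)

/-- Doubling for balls. -/
def Dbl {d : ℕ} (μ : Measure (Fin d → ℝ)) (D : ℝ≥0∞) : Prop :=
  ∀ c r, 0 < r → μ (Metric.ball c (4 * r)) ≤ D * μ (Metric.ball c r)

lemma mxf_weak {d : ℕ} (μ : Measure (Fin d → ℝ)) (D : ℝ≥0∞) (hD : Dbl μ D)
    (f : (Fin d → ℝ) → ℝ≥0∞) (t : ℝ≥0∞) :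
    t * μ {x | t < mxf μ f x} ≤ D * ∫⁻ x, f x ∂μ := by
  let E : ℕ → Set (Fin d → ℝ) := fun k => {x | ∃ c, ∃ r : ℝ, r ≤ k ∧ x ∈ Metric.ball c r ∧
      t < (∫⁻ y in Metric.ball c r, f y ∂μ) / μ (Metric.ball c r)}
  have hE : {x | t < mxf μ f x} ⊆ ⋃ k, E k := by
    intro x hx
    obtain ⟨c, r, h1, h2⟩ := lt_mxf μ f hx
    obtain ⟨k, hk⟩ := exists_nat_ge r
    exact mem_iUnion.2 ⟨k, c, r, hk, h1, h2⟩
  have hmono : Monotone E := by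
    intro k l hkl x ⟨c, r, h0, h1, h2⟩
    exact ⟨c, r, h0.trans (by exact_mod_cast hkl), h1, h2⟩
  have key : ∀ k, t * μ (E k) ≤ D * ∫⁻ x, f x ∂μ := by
    intro k
    let T : Set ((Fin d → ℝ) × ℝ) := {p | p.2 ≤ k ∧ 0 < p.2 ∧
      t < (∫⁻ y in Metric.ball p.1 p.2, f y ∂μ) / μ (Metric.ball p.1 p.2)}
    obtain ⟨u, huT, hdis, hcov⟩ := Vitali.exists_disjoint_subfamily_covering_enlargement_ball
      T (fun p => p.1) (fun p => p.2) k (fun p hp => hp.1) 4 (by norm_num)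
    have hcount : u.Countable := hdis.countable_of_isOpen (fun _ _ => Metric.isOpen_ball)
      (fun p hp => ⟨p.1, Metric.mem_ball_self (huT hp).2.1⟩)
    have hsub : E k ⊆ ⋃ p ∈ u, Metric.ball p.1 (4 * p.2) := by
      intro x ⟨c, r, h0, h1, h2⟩
      have hr : 0 < r := Metric.pos_of_mem_ball h1
      obtain ⟨b, hb, hsb⟩ := hcov (c, r) ⟨h0, hr, h2⟩
      exact mem_biUnion hb (hsb h1)
    have := hcount.to_subtype
    calc t * μ (E k) ≤ t * ∑' p : u, μ (Metric.ball p.1.1 (4 * p.1.2)) := by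
          gcongr
          exact (measure_mono hsub).trans (measure_biUnion_le μ hcount _)
      _ = ∑' p : u, t * μ (Metric.ball p.1.1 (4 * p.1.2)) := ENNReal.tsum_mul_left.symm
      _ ≤ ∑' p : u, D * ∫⁻ y in Metric.ball p.1.1 p.1.2, f y ∂μ := by
          refine ENNReal.tsum_le_tsum fun p => ?_
          have hp := huT p.2
          calc t * μ (Metric.ball p.1.1 (4 * p.1.2)) ≤ t * (D * μ (Metric.ball p.1.1 p.1.2)) := by
                gcongr; exact hD _ _ hp.2.1
            _ = D * (t * μ (Metric.ball p.1.1 p.1.2)) := by ring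
            _ ≤ _ := by
                gcongr
                exact ENNReal.mul_le_of_le_div hp.2.2.le
      _ = D * ∑' p : u, ∫⁻ y in Metric.ball p.1.1 p.1.2, f y ∂μ := ENNReal.tsum_mul_left
      _ = D * ∫⁻ y in ⋃ p ∈ u, Metric.ball p.1 p.2, f y ∂μ := by
          rw [lintegral_biUnion hcount (fun _ _ => Metric.isOpen_ball.measurableSet) hdis]
      _ ≤ _ := by gcongr; exact Measure.restrict_le_self
  calc t * μ {x | t < mxf μ f x} ≤ t * μ (⋃ k, E k) := by gcongr
    _ = ⨆ k, t * μ (E k) := by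
        rw [hmono.directed_le.measure_iUnion, ENNReal.mul_iSup]
    _ ≤ _ := iSup_le key

lemma mxf_weak2 {d : ℕ} (μ : Measure (Fin d → ℝ)) (D : ℝ≥0∞) (hD : Dbl μ D)
    (f : (Fin d → ℝ) → ℝ≥0∞) (t : ℝ≥0∞) :
    t * μ {x | t < mxf μ f x} ≤ 2 * D * ∫⁻ x, {x | t < 2 * f x}.indicator f x ∂μ := by
  have hsub : {x | t < mxf μ f x} ⊆ {x | t / 2 < mxf μ ({x | t < 2 * f x}.indicator f) x} := by
    intro x hx
    have h1 : mxf μ f x ≤ mxf μ ({x | t < 2 * f x}.indicator f) x + t / 2 := by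
      refine mxf_le μ f fun c r hx => ?_
      have h2 : ∫⁻ y in Metric.ball c r, f y ∂μ ≤
          (∫⁻ y in Metric.ball c r, {x | t < 2 * f x}.indicator f y ∂μ)
            + t / 2 * μ (Metric.ball c r) := by
        rw [← setLIntegral_const, ← lintegral_add_right _ measurable_const]
        refine lintegral_mono fun y => ?_
        by_cases hy : t < 2 * f y
        · rw [indicator_of_mem (show y ∈ {x | t < 2 * f x} from hy)]; exact le_self_add
        · rw [indicator_of_notMem (show y ∉ {x | t < 2 * f x} from hy), zero_add]
          rw [ENNReal.le_div_iff_mul_le (by simp) (by simp), mul_comm]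
          exact not_lt.1 hy
      calc _ ≤ _ := ENNReal.div_le_div_right h2 _
        _ = _ := ENNReal.add_div
        _ ≤ _ := by
          refine add_le_add (le_mxf μ _ hx) ?_
          rw [mul_div_assoc]
          exact mul_le_of_le_one_right' ENNReal.div_self_le_one
    by_contra hcon
    have h3 : mxf μ f x ≤ t / 2 + t / 2 := h1.trans (by gcongr; exact not_lt.1 hcon)
    rw [ENNReal.add_halves] at h3
    exact absurd h3 (not_le.2 hx)
  have h4 := mxf_weak μ D hD ({x | t < 2 * f x}.indicator f) (t / 2)
  calc t * μ {x | t < mxf μ f x}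
      ≤ t * μ {x | t / 2 < mxf μ ({x | t < 2 * f x}.indicator f) x} := by gcongr
    _ = 2 * (t / 2 * μ {x | t / 2 < mxf μ ({x | t < 2 * f x}.indicator f) x}) := by
        rw [← mul_assoc, ENNReal.mul_div_cancel (by simp) (by simp)]
    _ ≤ 2 * (D * ∫⁻ x, {x | t < 2 * f x}.indicator f x ∂μ) := by gcongr
    _ = _ := by ring

lemma powInt (s : ℝ) (hs : 0 < s) (a : ℝ≥0∞) :
    ∫⁻ t in Ioi (0 : ℝ), {t : ℝ | ENNReal.ofReal t < a}.indicator
      (fun t => ENNReal.ofReal (t ^ (s - 1))) t = ENNReal.ofReal (1 / s) * a ^ s := by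
  by_cases ha : a = ⊤
  · subst ha
    have : {t : ℝ | ENNReal.ofReal t < ⊤} = univ := by ext; simp
    rw [this, ENNReal.top_rpow_of_pos hs, ENNReal.mul_top (by simpa using hs)]
    simp only [indicator_univ]
    by_contra hcon
    refine not_integrableOn_Ioi_rpow (s - 1) ⟨by fun_prop, ?_⟩
    rw [hasFiniteIntegral_iff_ofReal]
    · exact lt_top_iff_ne_top.2 hcon
    · filter_upwards [self_mem_ae_restrict measurableSet_Ioi] with x hx
      exact Real.rpow_nonneg (le_of_lt hx) _
  · lift a to NNReal using ha
    have hset : ∀ t ∈ Ioi (0 : ℝ), {t : ℝ | ENNReal.ofReal t < a}.indicator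
      (fun t => ENNReal.ofReal (t ^ (s - 1))) t = (Iio (a : ℝ)).indicator
      (fun t => ENNReal.ofReal (t ^ (s - 1))) t := by
      intro t ht
      have : ENNReal.ofReal t < a ↔ t < a := by
        rw [ENNReal.ofReal_lt_iff_lt_toReal (le_of_lt ht) (by simp)]; simp
      by_cases h : t < a <;> simp [indicator, this, h]
    rw [setLIntegral_congr_fun measurableSet_Ioi hset, lintegral_indicator measurableSet_Iio,
      Measure.restrict_restrict measurableSet_Iio, Iio_inter_Ioi,
      ← ofReal_integral_eq_lintegral_ofReal, ← integral_Ioc_eq_integral_Ioo,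
      ← intervalIntegral.integral_of_le a.coe_nonneg, integral_rpow (Or.inl (by linarith))]
    · rw [sub_add_cancel, Real.zero_rpow hs.ne', sub_zero, div_eq_inv_mul,
        ENNReal.ofReal_mul (by positivity), one_div, ← ENNReal.ofReal_rpow_of_nonneg a.coe_nonneg hs.le]
      simp
    · have := (intervalIntegral.intervalIntegrable_rpow' (a := 0) (b := a) (r := s - 1)
        (by linarith)).1
      exact this.mono_set Ioo_subset_Ioc_self
    · filter_upwards [self_mem_ae_restrict measurableSet_Ioo] with x hx
      exact Real.rpow_nonneg (le_of_lt hx.1) _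

lemma layer {d : ℕ} (μ : Measure (Fin d → ℝ)) [SFinite μ] (f g : (Fin d → ℝ) → ℝ≥0∞)
    (hf : Measurable f) (hg : Measurable g) (s : ℝ) (hs : 0 < s) :
    ENNReal.ofReal (1 / s) * ∫⁻ x, f x * g x ^ s ∂μ = ∫⁻ t in Ioi (0 : ℝ),
      ENNReal.ofReal (t ^ (s - 1)) * ∫⁻ x, {x | ENNReal.ofReal t < g x}.indicator f x ∂μ := by
  rw [← lintegral_const_mul _ (by fun_prop)]
  have h1 : ∀ x, ENNReal.ofReal (1 / s) * (f x * g x ^ s) = ∫⁻ t in Ioi (0 : ℝ),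
      f x * {t : ℝ | ENNReal.ofReal t < g x}.indicator
      (fun t => ENNReal.ofReal (t ^ (s - 1))) t := by
    intro x
    rw [lintegral_const_mul, powInt s hs]
    · ring
    · exact Measurable.indicator (by fun_prop) (measurableSet_lt (by fun_prop) (by fun_prop))
  simp_rw [h1]
  have hm : Measurable (fun p : (Fin d → ℝ) × ℝ => f p.1 * {p : (Fin d → ℝ) × ℝ |
      ENNReal.ofReal p.2 < g p.1}.indicator (fun p => ENNReal.ofReal (p.2 ^ (s - 1))) p) := by
    refine (hf.comp measurable_fst).mul (Measurable.indicator (by fun_prop)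
      (measurableSet_lt (by fun_prop) (by fun_prop)))
  rw [lintegral_lintegral_swap]
  · refine lintegral_congr fun t => ?_
    rw [← lintegral_const_mul _ (hf.indicator (measurableSet_lt (by fun_prop) (by fun_prop)))]
    refine lintegral_congr fun x => ?_
    by_cases h : ENNReal.ofReal t < g x <;> simp [indicator, h, mul_comm]
  · exact hm.aemeasurable

lemma mxf_strong {d : ℕ} (s : ℝ) (hs : 1 < s) (D : ℝ≥0∞) (hD : D ≠ ⊤) :
    ∃ C : ℝ≥0∞, C ≠ ⊤ ∧ ∀ (μ : Measure (Fin d → ℝ)) [SFinite μ], Dbl μ D →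
      ∀ f : (Fin d → ℝ) → ℝ≥0∞, Measurable f →
        ∫⁻ x, mxf μ f x ^ s ∂μ ≤ C * ∫⁻ x, f x ^ s ∂μ := by
  refine ⟨ENNReal.ofReal s * (2 * D * (ENNReal.ofReal (1 / (s - 1)) * 2 ^ (s - 1))), ?_, ?_⟩
  · have : (2 : ℝ≥0∞) ^ (s - 1) ≠ ⊤ := ENNReal.rpow_ne_top_of_nonneg (by linarith) (by simp)
    finiteness
  intro μ _ hdbl f hf
  have h1 := layer μ (fun _ => 1) (mxf μ f) measurable_const (mxf_measurable μ f) s (by linarith)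
  have h2 := layer μ f (fun x => 2 * f x) hf (by fun_prop) (s - 1) (by linarith)
  simp only [one_mul] at h1
  have h3 : ENNReal.ofReal (1 / s) * ∫⁻ x, mxf μ f x ^ s ∂μ ≤
      2 * D * (ENNReal.ofReal (1 / (s - 1)) * ∫⁻ x, f x * (2 * f x) ^ (s - 1) ∂μ) := by
    rw [h1, h2, ← lintegral_const_mul]
    · refine setLIntegral_mono_ae' measurableSet_Ioi (Filter.Eventually.of_forall fun t ht => ?_)
      have ht' : 0 < t := ht
      have h4 := mxf_weak2 μ D hdbl f (ENNReal.ofReal t)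
      have h5 : ∫⁻ x, {x | ENNReal.ofReal t < mxf μ f x}.indicator (fun _ => (1 : ℝ≥0∞)) x ∂μ
          = μ {x | ENNReal.ofReal t < mxf μ f x} := by
        have hms : MeasurableSet {x | ENNReal.ofReal t < mxf μ f x} :=
          measurableSet_lt (by fun_prop) (mxf_measurable μ f)
        exact lintegral_indicator_one hms
      rw [h5]
      have h6 : ENNReal.ofReal (t ^ (s - 1)) =
          ENNReal.ofReal (t ^ (s - 1 - 1)) * ENNReal.ofReal t := by
        rw [← ENNReal.ofReal_mul (Real.rpow_nonneg ht'.le _)]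
        congr 1
        nth_rewrite 3 [← Real.rpow_one t]
        rw [← Real.rpow_add ht']; congr 1; ring
      rw [h6, mul_assoc]
      calc _ ≤ _ := mul_le_mul_right h4 _
        _ = _ := by ring
    · refine Measurable.mul (by fun_prop) ?_
      refine Measurable.lintegral_prod_right'
        (f := fun p : ℝ × (Fin d → ℝ) => {x | ENNReal.ofReal p.1 < 2 * f x}.indicator f p.2) ?_
      exact Measurable.indicator (s := {p : ℝ × (Fin d → ℝ) | ENNReal.ofReal p.1 < 2 * f p.2})
        (hf.comp measurable_snd) (measurableSet_lt (by fun_prop) (by fun_prop))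
  have h7 : ∀ x, f x * (2 * f x) ^ (s - 1) = 2 ^ (s - 1) * f x ^ s := by
    intro x
    rw [ENNReal.mul_rpow_of_nonneg _ _ (by linarith), mul_left_comm]
    congr 1
    nth_rewrite 1 [← ENNReal.rpow_one (f x)]
    rw [← ENNReal.rpow_add_of_nonneg _ _ (by linarith) (by linarith)]; congr 1; ring
  simp_rw [h7] at h3
  rw [lintegral_const_mul _ (by fun_prop)] at h3
  calc ∫⁻ x, mxf μ f x ^ s ∂μ
      = ENNReal.ofReal s * (ENNReal.ofReal (1 / s) * ∫⁻ x, mxf μ f x ^ s ∂μ) := by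
        rw [← mul_assoc, ← ENNReal.ofReal_mul (by linarith), mul_one_div_cancel (by linarith)]
        simp
    _ ≤ _ := mul_le_mul_right h3 _
    _ = _ := by ring

/-- `ℝ≥0∞`-valued `A₁` weights over cubes. -/
structure A1w {d : ℕ} (K : ℝ≥0∞) (u : (Fin d → ℝ) → ℝ≥0∞) : Prop where
  meas : Measurable u
  ne0 : ∀ x, u x ≠ 0
  net : ∀ x, u x ≠ ⊤
  avg : ∀ c r, ∀ᵐ y ∂(volume : Measure (Fin d → ℝ)), y ∈ Metric.ball c r →
    ∫⁻ z in Metric.ball c r, u z ≤ K * volume (Metric.ball c r) * u y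

/-- A pair of dual `A_p` weights. -/
structure ApP {d : ℕ} (p q : ℝ) (A : ℝ≥0∞) (w σ : (Fin d → ℝ) → ℝ≥0∞) : Prop where
  mw : Measurable w
  ms : Measurable σ
  w0 : ∀ x, w x ≠ 0
  wt : ∀ x, w x ≠ ⊤
  s0 : ∀ x, σ x ≠ 0
  st : ∀ x, σ x ≠ ⊤
  rel : ∀ x, σ x = w x ^ (1 - q)
  rel' : ∀ x, w x = σ x ^ (1 - p)
  ap : ∀ c r, 0 < r → (∫⁻ x in Metric.ball c r, w x) * (∫⁻ x in Metric.ball c r, σ x) ^ (p - 1)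
    ≤ A * volume (Metric.ball c r) ^ p

lemma hconj_mul {p q : ℝ} (h : p.HolderConjugate q) : (p - 1) * (q - 1) = 1 := by
  have := h.mul_eq_add; nlinarith

lemma ApP.symm {d : ℕ} {p q : ℝ} (hpq : p.HolderConjugate q) {A : ℝ≥0∞}
    {w σ : (Fin d → ℝ) → ℝ≥0∞} (h : ApP p q A w σ) : ApP q p (A ^ (q - 1)) σ w where
  mw := h.ms
  ms := h.mw
  w0 := h.s0
  wt := h.st
  s0 := h.w0
  st := h.wt
  rel := h.rel'
  rel' := h.rel
  ap := by
    intro c r hr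
    have hq := hpq.symm.lt
    have h1 := ENNReal.rpow_le_rpow (h.ap c r hr) (by linarith : 0 ≤ q - 1)
    rw [ENNReal.mul_rpow_of_nonneg _ _ (by linarith), ENNReal.mul_rpow_of_nonneg _ _ (by linarith),
      ← ENNReal.rpow_mul, ← ENNReal.rpow_mul, hconj_mul hpq, ENNReal.rpow_one, mul_comm] at h1
    have : p * (q - 1) = q := by have := hpq.mul_eq_add; linarith
    rwa [this] at h1

lemma vol_ball_ne_zero {d : ℕ} (c : Fin d → ℝ) {r : ℝ} (hr : 0 < r) :
    volume (Metric.ball c r) ≠ 0 := (Metric.measure_ball_pos volume c hr).ne'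

lemma vol_ball_ne_top {d : ℕ} (c : Fin d → ℝ) (r : ℝ) :
    volume (Metric.ball c r) ≠ ⊤ := measure_ball_lt_top.ne

lemma int_ball_ne_zero {d : ℕ} {u : (Fin d → ℝ) → ℝ≥0∞} (hu : Measurable u) (h0 : ∀ x, u x ≠ 0)
    (c : Fin d → ℝ) {r : ℝ} (hr : 0 < r) : ∫⁻ z in Metric.ball c r, u z ≠ 0 := by
  intro h
  rw [lintegral_eq_zero_iff hu] at h
  have : ∀ᵐ y ∂(volume.restrict (Metric.ball c r)), False := by
    filter_upwards [h] with y hy using h0 y hy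
  rw [Filter.eventually_false_iff_eq_bot, ae_eq_bot, Measure.restrict_eq_zero] at this
  exact vol_ball_ne_zero c hr this

lemma A1w.int_ne_top {d : ℕ} {K : ℝ≥0∞} (hK : K ≠ ⊤) {u : (Fin d → ℝ) → ℝ≥0∞} (h : A1w K u)
    (c : Fin d → ℝ) (r : ℝ) : ∫⁻ z in Metric.ball c r, u z ≠ ⊤ := by
  rcases le_or_gt r 0 with hr | hr
  · simp [Metric.ball_eq_empty.2 hr]
  by_contra hcon
  have : ∀ᵐ y ∂(volume.restrict (Metric.ball c r)), False := by
    rw [ae_restrict_iff' Metric.isOpen_ball.measurableSet]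
    filter_upwards [h.avg c r] with y hy hyb
    have := hy hyb
    rw [hcon, top_le_iff] at this
    exact ENNReal.mul_ne_top (ENNReal.mul_ne_top hK (vol_ball_ne_top c r)) (h.net y) this
  rw [Filter.eventually_false_iff_eq_bot, ae_eq_bot, Measure.restrict_eq_zero] at this
  exact vol_ball_ne_zero c hr this

/-- The weight `u v^{1-p}`. -/
def fw {d : ℕ} (p : ℝ) (u v : (Fin d → ℝ) → ℝ≥0∞) (x : Fin d → ℝ) : ℝ≥0∞ := u x * v x ^ (1 - p)

lemma fw_meas {d : ℕ} (p : ℝ) {u v : (Fin d → ℝ) → ℝ≥0∞} (hu : Measurable u) (hv : Measurable v) :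
    Measurable (fw p u v) := hu.mul (hv.pow_const _)

lemma fw_rel {d : ℕ} {p q : ℝ} (hpq : p.HolderConjugate q) {K : ℝ≥0∞}
    {u v : (Fin d → ℝ) → ℝ≥0∞} (hu : A1w K u) (hv : A1w K v) (x : Fin d → ℝ) :
    fw q v u x = fw p u v x ^ (1 - q) := by
  unfold fw
  have h0 : v x ^ (1 - p) ≠ ⊤ := by simp [ENNReal.rpow_eq_top_iff, hv.ne0, hv.net]
  have h1 : (1 - p) * (1 - q) = 1 := by have := hconj_mul hpq; linarith
  rw [ENNReal.mul_rpow_of_ne_top (hu.net x) h0, ← ENNReal.rpow_mul, h1, ENNReal.rpow_one, mul_comm]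

lemma fw_int {d : ℕ} {p : ℝ} (hp : 1 < p) {K : ℝ≥0∞}
    {u v : (Fin d → ℝ) → ℝ≥0∞} (hu : A1w K u) (hv : A1w K v) (c : Fin d → ℝ) (r : ℝ) :
    ∫⁻ x in Metric.ball c r, fw p u v x ≤
      ((∫⁻ x in Metric.ball c r, v x) / (K * volume (Metric.ball c r))) ^ (1 - p) *
        ∫⁻ x in Metric.ball c r, u x := by
  rw [← lintegral_const_mul _ hu.meas]
  refine lintegral_mono_ae ?_
  rw [ae_restrict_iff' Metric.isOpen_ball.measurableSet]
  filter_upwards [hv.avg c r] with y hy hyb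
  unfold fw
  rw [mul_comm]
  gcongr ?_ * _
  rw [show 1 - p = -(p - 1) by ring, ENNReal.rpow_neg, ENNReal.rpow_neg, ENNReal.inv_le_inv]
  refine ENNReal.rpow_le_rpow ?_ (by linarith)
  refine ENNReal.div_le_of_le_mul ?_
  rw [mul_comm]; exact hy hyb

lemma ApP_of_A1 {d : ℕ} {p q : ℝ} (hpq : p.HolderConjugate q) {K : ℝ≥0∞} (hK0 : K ≠ 0) (hK : K ≠ ⊤)
    {u v : (Fin d → ℝ) → ℝ≥0∞} (hu : A1w K u) (hv : A1w K v) :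
    ApP p q (K ^ p) (fw p u v) (fw q v u) where
  mw := fw_meas _ hu.meas hv.meas
  ms := fw_meas _ hv.meas hu.meas
  w0 := fun x => by
    have := hpq.lt
    simp [fw, ENNReal.rpow_eq_zero_iff, hu.ne0, hv.net, hv.ne0]
  wt := fun x => ENNReal.mul_ne_top (hu.net x) (by simp [ENNReal.rpow_eq_top_iff, hv.ne0, hv.net])
  s0 := fun x => by
    simp [fw, ENNReal.rpow_eq_zero_iff, hv.ne0, hu.net, hu.ne0]
  st := fun x => ENNReal.mul_ne_top (hv.net x) (by simp [ENNReal.rpow_eq_top_iff, hu.ne0, hu.net])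
  rel := fw_rel hpq hu hv
  rel' := fw_rel hpq.symm hv hu
  ap := by
    intro c r hr
    have hp := hpq.lt
    have hq := hpq.symm.lt
    have h1 := fw_int hp hu hv c r
    have h2 := fw_int hq hv hu c r
    have hV := vol_ball_ne_zero c hr
    have hVt := vol_ball_ne_top c r
    have hU0 := int_ball_ne_zero hu.meas hu.ne0 c hr
    have hUt := hu.int_ne_top hK c r
    have hW0 := int_ball_ne_zero hv.meas hv.ne0 c hr
    have hWt := hv.int_ne_top hK c r
    set Q := volume (Metric.ball c r)
    set U := ∫⁻ x in Metric.ball c r, u x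
    set W := ∫⁻ x in Metric.ball c r, v x
    have hKQ0 : K * Q ≠ 0 := mul_ne_zero hK0 hV
    have hKQt : K * Q ≠ ⊤ := ENNReal.mul_ne_top hK hVt
    rw [← ENNReal.mul_rpow_of_nonneg _ _ (by linarith)]
    set R := K * Q
    calc _ ≤ ((W / R) ^ (1 - p) * U) * ((U / R) ^ (1 - q) * W) ^ (p - 1) := by
          gcongr
      _ = R ^ p := by
          have hc : (1 - q) * (p - 1) = -1 := by have := hconj_mul hpq; linarith
          rw [ENNReal.mul_rpow_of_nonneg _ _ (by linarith), ← ENNReal.rpow_mul, hc,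
            ENNReal.rpow_neg_one]
          have e1 : U * (U / R)⁻¹ = R := by
            rw [ENNReal.inv_div (Or.inl hKQt) (Or.inl hKQ0), ENNReal.mul_div_cancel hU0 hUt]
          have e2 : (W / R) ^ (1 - p) * W ^ (p - 1) = R ^ (p - 1) := by
            rw [show 1 - p = -(p - 1) by ring, ENNReal.rpow_neg, ← ENNReal.inv_rpow,
              ← ENNReal.mul_rpow_of_nonneg _ _ (by linarith),
              ENNReal.inv_div (Or.inl hKQt) (Or.inl hKQ0), mul_comm,
              ENNReal.mul_div_cancel hW0 hWt]
          calc _ = (U * (U / R)⁻¹) * ((W / R) ^ (1 - p) * W ^ (p - 1)) := by ring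
            _ = R * R ^ (p - 1) := by rw [e1, e2]
            _ = R ^ (1 + (p - 1)) := by
              rw [ENNReal.rpow_add _ _ hKQ0 hKQt, ENNReal.rpow_one]
            _ = R ^ p := by congr 1; ring

lemma ApP.holder {d : ℕ} {p q : ℝ} (hpq : p.HolderConjugate q) {A : ℝ≥0∞}
    {w σ : (Fin d → ℝ) → ℝ≥0∞} (h : ApP p q A w σ) (c : Fin d → ℝ) (r : ℝ) :
    volume (Metric.ball c r) ^ p ≤
      (∫⁻ x in Metric.ball c r, w x) * (∫⁻ x in Metric.ball c r, σ x) ^ (p - 1) := by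
  have hp := hpq.lt
  have hq := hpq.symm.lt
  have h1 := ENNReal.lintegral_mul_norm_pow_le (μ := volume.restrict (Metric.ball c r))
    h.mw.aemeasurable h.ms.aemeasurable (p := 1 / p) (q := 1 / q) (by positivity) (by positivity)
    (by have := hpq.inv_add_inv_eq_one; simpa using this)
  have h2 : ∀ x, w x ^ (1 / p) * σ x ^ (1 / q) = 1 := by
    intro x
    rw [h.rel, ← ENNReal.rpow_mul, ← ENNReal.rpow_add _ _ (h.w0 x) (h.wt x)]
    have : 1 / p + (1 - q) * (1 / q) = 0 := by
      have h3 := hpq.mul_eq_add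
      have : p ≠ 0 := by linarith
      have : q ≠ 0 := by linarith
      field_simp
      linarith
    rw [this, ENNReal.rpow_zero]
  simp_rw [h2] at h1
  rw [setLIntegral_one] at h1
  have h4 := ENNReal.rpow_le_rpow h1 (by linarith : 0 ≤ p)
  rw [ENNReal.mul_rpow_of_nonneg _ _ (by linarith), ← ENNReal.rpow_mul, ← ENNReal.rpow_mul] at h4
  have e1 : 1 / p * p = 1 := by field_simp
  have e2 : 1 / q * p = p - 1 := by
    have h3 := hpq.mul_eq_add
    field_simp
    linarith
  rwa [e1, e2, ENNReal.rpow_one] at h4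

lemma ApP.dbl {d : ℕ} {p q : ℝ} (hpq : p.HolderConjugate q) {A : ℝ≥0∞} (hA : A ≠ ⊤)
    {w σ : (Fin d → ℝ) → ℝ≥0∞} (h : ApP p q A w σ) :
    Dbl (volume.withDensity w) (A * (4 ^ d) ^ p) := by
  intro c r hr
  have hp := hpq.lt
  rw [withDensity_apply _ Metric.isOpen_ball.measurableSet,
    withDensity_apply _ Metric.isOpen_ball.measurableSet]
  have h4r : 0 < 4 * r := by linarith
  have h1 := h.ap c (4 * r) h4r
  have h2 := h.holder hpq c r
  have hs0 := int_ball_ne_zero h.ms h.s0 c h4r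
  have hw0 := int_ball_ne_zero h.mw h.w0 c h4r
  have hvol : volume (Metric.ball c (4 * r)) = 4 ^ d * volume (Metric.ball c r) := by
    rw [Real.volume_pi_ball _ hr, Real.volume_pi_ball _ h4r, Fintype.card_fin,
      show 2 * (4 * r) = 4 * (2 * r) by ring, mul_pow, ENNReal.ofReal_mul (by positivity)]
    simp [ENNReal.ofReal_pow]
  have hst : (∫⁻ x in Metric.ball c (4 * r), σ x) ^ (p - 1) ≠ ⊤ := by
    intro hcon
    rw [hcon, ENNReal.mul_top hw0, top_le_iff] at h1
    exact ENNReal.mul_ne_top hA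
      (ENNReal.rpow_ne_top_of_nonneg (by linarith) (vol_ball_ne_top _ _)) h1
  have hs0' : (∫⁻ x in Metric.ball c (4 * r), σ x) ^ (p - 1) ≠ 0 := by
    simp only [ne_eq, ENNReal.rpow_eq_zero_iff, not_or, not_and]
    exact ⟨fun h' => absurd h' hs0, fun _ => by linarith⟩
  have hmono : (∫⁻ x in Metric.ball c r, σ x) ≤ ∫⁻ x in Metric.ball c (4 * r), σ x :=
    lintegral_mono_set (Metric.ball_subset_ball (by linarith))
  rw [← ENNReal.mul_le_mul_iff_left hs0' hst]
  calc _ ≤ _ := h1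
    _ = A * (4 ^ d) ^ p * volume (Metric.ball c r) ^ p := by
        rw [hvol, ENNReal.mul_rpow_of_nonneg _ _ (by linarith), mul_assoc]
    _ ≤ A * (4 ^ d) ^ p * ((∫⁻ x in Metric.ball c r, w x) *
          (∫⁻ x in Metric.ball c (4 * r), σ x) ^ (p - 1)) := by
        gcongr
        exact h2.trans (by gcongr)
    _ = _ := by ring

lemma wd_int {d : ℕ} {w f : (Fin d → ℝ) → ℝ≥0∞} (hw : Measurable w) (hf : Measurable f) :
    ∫⁻ x, f x ∂(volume.withDensity w) = ∫⁻ x, f x * w x := by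
  rw [lintegral_withDensity_eq_lintegral_mul _ hw hf]
  simp [mul_comm]

lemma wd_setint {d : ℕ} {w f : (Fin d → ℝ) → ℝ≥0∞} (hw : Measurable w) (hf : Measurable f)
    (c : Fin d → ℝ) (r : ℝ) :
    ∫⁻ x in Metric.ball c r, f x ∂(volume.withDensity w) = ∫⁻ x in Metric.ball c r, f x * w x := by
  rw [setLIntegral_withDensity_eq_setLIntegral_mul _ hw hf Metric.isOpen_ball.measurableSet]
  simp [mul_comm]

lemma muck_ptwise {d : ℕ} {p q : ℝ} (hpq : p.HolderConjugate q) {A : ℝ≥0∞} (hA : A ≠ ⊤)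
    {w σ : (Fin d → ℝ) → ℝ≥0∞} (h : ApP p q A w σ)
    {f : (Fin d → ℝ) → ℝ≥0∞} (hf : Measurable f) (x : Fin d → ℝ) :
    mxf volume f x ^ (p - 1) ≤ A * mxf (volume.withDensity w) (fun y =>
      mxf (volume.withDensity σ) (fun z => f z * (σ z)⁻¹) y ^ (p - 1) * (w y)⁻¹) x := by
  have hp := hpq.lt
  have hfs : Measurable (fun z => f z * (σ z)⁻¹) := hf.mul h.ms.inv
  set F := mxf (volume.withDensity σ) (fun z => f z * (σ z)⁻¹) with hF
  have hFm : Measurable F := mxf_measurable _ _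
  have hFw : Measurable (fun y => F y ^ (p - 1) * (w y)⁻¹) := (hFm.pow_const _).mul h.mw.inv
  set G := mxf (volume.withDensity w) (fun y => F y ^ (p - 1) * (w y)⁻¹) x with hG
  have hp1 : 0 < p - 1 := by linarith
  rw [← ENNReal.le_rpow_inv_iff hp1]
  refine mxf_le _ _ fun c r hx => ?_
  rw [ENNReal.le_rpow_inv_iff hp1]
  have hr : 0 < r := Metric.pos_of_mem_ball hx
  have hQ0 := vol_ball_ne_zero c hr
  have hQt := vol_ball_ne_top c r
  have hap := h.ap c r hr
  have hs0 := int_ball_ne_zero h.ms h.s0 c hr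
  have hw0 := int_ball_ne_zero h.mw h.w0 c hr
  set I := ∫⁻ y in Metric.ball c r, f y
  set S := ∫⁻ y in Metric.ball c r, σ y
  set W := ∫⁻ y in Metric.ball c r, w y
  set Q := volume (Metric.ball c r)
  have e1 : ∫⁻ y in Metric.ball c r, f y * (σ y)⁻¹ ∂(volume.withDensity σ) = I := by
    rw [wd_setint h.ms hfs]
    refine lintegral_congr fun y => ?_
    rw [mul_assoc, ENNReal.inv_mul_cancel (h.s0 y) (h.st y), mul_one]
  have e2 : ∫⁻ y in Metric.ball c r, F y ^ (p - 1) * (w y)⁻¹ ∂(volume.withDensity w)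
      = ∫⁻ y in Metric.ball c r, F y ^ (p - 1) := by
    rw [wd_setint h.mw hFw]
    refine lintegral_congr fun y => ?_
    rw [mul_assoc, ENNReal.inv_mul_cancel (h.w0 y) (h.wt y), mul_one]
  have hFge : ∀ y ∈ Metric.ball c r, I / S ≤ F y := by
    intro y hy
    have := le_mxf (volume.withDensity σ) (fun z => f z * (σ z)⁻¹) hy
    rwa [e1, withDensity_apply _ Metric.isOpen_ball.measurableSet] at this
  have h3 : (I / S) ^ (p - 1) * Q ≤ ∫⁻ y in Metric.ball c r, F y ^ (p - 1) := by
    rw [← setLIntegral_const]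
    refine setLIntegral_mono_ae' Metric.isOpen_ball.measurableSet
      (Filter.Eventually.of_forall fun y hy => ?_)
    exact ENNReal.rpow_le_rpow (hFge y hy) hp1.le
  have hAQ : A * Q ^ p ≠ ⊤ :=
    ENNReal.mul_ne_top hA (ENNReal.rpow_ne_top_of_nonneg (by linarith) hQt)
  have hS1 : S ^ (p - 1) ≠ 0 := by
    simp only [ne_eq, ENNReal.rpow_eq_zero_iff, not_or, not_and]
    exact ⟨fun h' => absurd h' hs0, fun _ => by linarith⟩
  have hWt : W ≠ ⊤ := by
    intro hc
    rw [hc, ENNReal.top_mul hS1, top_le_iff] at hap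
    exact hAQ hap
  have hSt : S ≠ ⊤ := by
    intro hc
    rw [hc, ENNReal.top_rpow_of_pos hp1, ENNReal.mul_top hw0, top_le_iff] at hap
    exact hAQ hap
  have h4 : (∫⁻ y in Metric.ball c r, F y ^ (p - 1)) / W ≤ G := by
    have := le_mxf (volume.withDensity w) (fun y => F y ^ (p - 1) * (w y)⁻¹) hx
    rwa [e2, withDensity_apply _ Metric.isOpen_ball.measurableSet] at this
  rw [ENNReal.div_le_iff hw0 hWt] at h4
  have hQp0 : Q ^ p ≠ 0 := by
    simp only [ne_eq, ENNReal.rpow_eq_zero_iff, not_or, not_and]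
    exact ⟨fun h' => absurd h' hQ0, fun _ => by linarith⟩
  have hQpt : Q ^ p ≠ ⊤ := ENNReal.rpow_ne_top_of_nonneg (by linarith) hQt
  rw [← ENNReal.mul_le_mul_iff_left hQp0 hQpt]
  calc (I / Q) ^ (p - 1) * Q ^ p = (I / Q) ^ (p - 1) * (Q ^ (p - 1) * Q ^ (1 : ℝ)) := by
        rw [← ENNReal.rpow_add _ _ hQ0 hQt]; congr 2; ring
    _ = I ^ (p - 1) * Q := by
        rw [← mul_assoc, ← ENNReal.mul_rpow_of_nonneg _ _ hp1.le,
          ENNReal.div_mul_cancel hQ0 hQt, ENNReal.rpow_one]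
    _ = ((I / S) ^ (p - 1) * Q) * S ^ (p - 1) := by
        nth_rewrite 1 [← ENNReal.div_mul_cancel hs0 hSt (b := I)]
        rw [ENNReal.mul_rpow_of_nonneg _ _ hp1.le]; ring
    _ ≤ (G * W) * S ^ (p - 1) := mul_le_mul_left (h3.trans h4) _
    _ = G * (W * S ^ (p - 1)) := by ring
    _ ≤ G * (A * Q ^ p) := by gcongr
    _ = _ := by ring

lemma muck {d : ℕ} {p q : ℝ} (hpq : p.HolderConjugate q) {A : ℝ≥0∞} (hA : A ≠ ⊤) :
    ∃ C : ℝ≥0∞, C ≠ ⊤ ∧ ∀ w σ : (Fin d → ℝ) → ℝ≥0∞, ApP p q A w σ →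
      ∀ f : (Fin d → ℝ) → ℝ≥0∞, Measurable f →
        ∫⁻ x, mxf volume f x ^ p * w x ≤ C * ∫⁻ x, f x ^ p * w x := by
  have hp := hpq.lt
  have hq := hpq.symm.lt
  have hp1 : 0 < p - 1 := by linarith
  have hA' : A ^ (q - 1) ≠ ⊤ := ENNReal.rpow_ne_top_of_nonneg (by linarith) hA
  have h4d : ∀ s : ℝ, 0 ≤ s → ((4 : ℝ≥0∞) ^ d) ^ s ≠ ⊤ := fun s hs =>
    ENNReal.rpow_ne_top_of_nonneg hs (by simp)
  obtain ⟨C1, hC1, H1⟩ := mxf_strong (d := d) q hq (A * (4 ^ d) ^ p)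
    (ENNReal.mul_ne_top hA (h4d _ (by linarith)))
  obtain ⟨C2, hC2, H2⟩ := mxf_strong (d := d) p hp (A ^ (q - 1) * (4 ^ d) ^ q)
    (ENNReal.mul_ne_top hA' (h4d _ (by linarith)))
  refine ⟨A ^ q * C1 * C2, ENNReal.mul_ne_top (ENNReal.mul_ne_top
    (ENNReal.rpow_ne_top_of_nonneg (by linarith) hA) hC1) hC2, ?_⟩
  intro w σ h f hf
  have : SigmaFinite (volume.withDensity w) :=
    SigmaFinite.withDensity_of_ne_top (Filter.Eventually.of_forall h.wt)
  have : SigmaFinite (volume.withDensity σ) :=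
    SigmaFinite.withDensity_of_ne_top (Filter.Eventually.of_forall h.st)
  have hfs : Measurable (fun z => f z * (σ z)⁻¹) := hf.mul h.ms.inv
  have hpt := muck_ptwise hpq hA h hf
  have G1 := H2 (volume.withDensity σ) ((h.symm hpq).dbl hpq.symm hA') _ hfs
  set F := mxf (volume.withDensity σ) (fun z => f z * (σ z)⁻¹) with hF
  have hFm : Measurable F := mxf_measurable _ _
  have hFw : Measurable (fun y => F y ^ (p - 1) * (w y)⁻¹) := (hFm.pow_const _).mul h.mw.inv
  have G2 := H1 (volume.withDensity w) (h.dbl hpq hA) _ hFw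
  set G := mxf (volume.withDensity w) (fun y => F y ^ (p - 1) * (w y)⁻¹) with hG
  have hGm : Measurable G := mxf_measurable _ _
  rw [wd_int h.mw (hGm.pow_const _), wd_int h.mw (hFw.pow_const _)] at G2
  rw [wd_int h.ms (hFm.pow_const _), wd_int h.ms (hfs.pow_const _)] at G1
  have epq : (p - 1) * q = p := by have := hpq.mul_eq_add; linarith
  have e1 : ∀ x, (F x ^ (p - 1) * (w x)⁻¹) ^ q * w x = F x ^ p * σ x := by
    intro x
    rw [ENNReal.mul_rpow_of_nonneg _ _ (by linarith), ← ENNReal.rpow_mul, epq, mul_assoc, h.rel x]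
    congr 1
    rw [ENNReal.inv_rpow, ← ENNReal.rpow_neg]
    nth_rewrite 2 [← ENNReal.rpow_one (w x)]
    rw [← ENNReal.rpow_add _ _ (h.w0 x) (h.wt x)]; congr 1; ring
  have e2 : ∀ x, (f x * (σ x)⁻¹) ^ p * σ x = f x ^ p * w x := by
    intro x
    rw [ENNReal.mul_rpow_of_nonneg _ _ (by linarith), mul_assoc, h.rel' x]
    congr 1
    rw [ENNReal.inv_rpow, ← ENNReal.rpow_neg]
    nth_rewrite 2 [← ENNReal.rpow_one (σ x)]
    rw [← ENNReal.rpow_add _ _ (h.s0 x) (h.st x)]; congr 1; ring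
  simp_rw [e1] at G2
  simp_rw [e2] at G1
  calc ∫⁻ x, mxf volume f x ^ p * w x ≤ ∫⁻ x, A ^ q * (G x ^ q * w x) := by
        refine lintegral_mono fun x => ?_
        rw [← mul_assoc, ← ENNReal.mul_rpow_of_nonneg _ _ (by linarith : 0 ≤ q)]
        gcongr
        have := ENNReal.rpow_le_rpow (hpt x) (by linarith : 0 ≤ q)
        rwa [← ENNReal.rpow_mul, epq] at this
    _ = A ^ q * ∫⁻ x, G x ^ q * w x := lintegral_const_mul _ ((hGm.pow_const _).mul h.mw)
    _ ≤ A ^ q * (C1 * (C2 * ∫⁻ x, f x ^ p * w x)) := by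
        gcongr
        exact G2.trans (by gcongr)
    _ = _ := by ring

lemma mxf_tsum_le {d : ℕ} (g : ℕ → (Fin d → ℝ) → ℝ≥0∞) (hg : ∀ k, Measurable (g k))
    (x : Fin d → ℝ) :
    mxf volume (fun y => ∑' k, g k y) x ≤ ∑' k, mxf volume (g k) x := by
  refine mxf_le _ _ fun c r hx => ?_
  rw [lintegral_tsum (fun k => (hg k).aemeasurable), div_eq_mul_inv, ← ENNReal.tsum_mul_right]
  exact ENNReal.tsum_le_tsum fun k => by
    rw [← div_eq_mul_inv]; exact le_mxf _ _ hx

lemma mxf_congr_int {d : ℕ} {f g : (Fin d → ℝ) → ℝ≥0∞} (h : f =ᵐ[volume] g) (x : Fin d → ℝ) :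
    mxf volume f x = mxf volume g x := by
  unfold mxf
  have : ∀ s, ∫⁻ y in s, f y = ∫⁻ y in s, g y := fun s =>
    lintegral_congr_ae (ae_restrict_of_ae h)
  simp_rw [this]

lemma mxf_pos {d : ℕ} {f : (Fin d → ℝ) → ℝ≥0∞} (h : ∫⁻ x, f x ≠ 0) (x : Fin d → ℝ) :
    mxf volume f x ≠ 0 := by
  intro hx
  apply h
  have h1 : ∀ k : ℕ, ∫⁻ y in Metric.ball x k, f y = 0 := by
    intro k
    rcases Nat.eq_zero_or_pos k with rfl | hk
    · simp
    have hk' : (0 : ℝ) < k := by exact_mod_cast hk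
    have := le_mxf volume f (Metric.mem_ball_self (x := x) hk')
    rw [hx, nonpos_iff_eq_zero, ENNReal.div_eq_zero_iff] at this
    exact this.resolve_right (vol_ball_ne_top _ _)
  have h2 : (⋃ k : ℕ, Metric.ball x k) = univ := Metric.iUnion_ball_nat x
  have h3 := lintegral_iUnion_le (μ := volume) (fun k : ℕ => Metric.ball x (k : ℝ)) f
  rw [h2, Measure.restrict_univ] at h3
  simpa [h1] using h3

/-- Rubio de Francia iterates. -/
def rdf {d : ℕ} (c : ℝ≥0∞) (h : (Fin d → ℝ) → ℝ≥0∞) : ℕ → (Fin d → ℝ) → ℝ≥0∞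
  | 0 => h
  | k + 1 => fun x => c * mxf volume (rdf c h k) x

lemma rdf_meas {d : ℕ} (c : ℝ≥0∞) {h : (Fin d → ℝ) → ℝ≥0∞} (hh : Measurable h) (k : ℕ) :
    Measurable (rdf c h k) := by
  cases k with
  | zero => exact hh
  | succ k => exact (mxf_measurable _ _).const_mul _

lemma rdf_thm {d : ℕ} {p q : ℝ} (hpq : p.HolderConjugate q) {A : ℝ≥0∞} (hA : A ≠ ⊤) :
    ∃ K : NNReal, 1 ≤ K ∧ ∀ w σ : (Fin d → ℝ) → ℝ≥0∞, ApP p q A w σ →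
      ∀ h : (Fin d → ℝ) → ℝ≥0∞, Measurable h → ∫⁻ x, h x ≠ 0 → ∫⁻ x, h x ^ p * w x ≠ ⊤ →
        ∃ H : (Fin d → ℝ) → ℝ≥0∞, A1w K H ∧ (∀ᵐ x, h x ≤ H x) ∧
          (∫⁻ x, H x ^ p * w x) ^ (1 / p) ≤ 2 * (∫⁻ x, h x ^ p * w x) ^ (1 / p) := by
  have hp := hpq.lt
  obtain ⟨C, hC, hM⟩ := muck (d := d) hpq hA
  -- operator norm bound
  set B : ℝ≥0∞ := max 1 (C ^ (1 / p)) with hB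
  have hBt : B ≠ ⊤ := by
    rw [hB]; exact max_ne_top (by simp) (ENNReal.rpow_ne_top_of_nonneg (by positivity) hC)
  have hB1 : 1 ≤ B := le_max_left _ _
  have hB0 : B ≠ 0 := (zero_lt_one.trans_le hB1).ne'
  have h2Bt : 2 * B ≠ ⊤ := ENNReal.mul_ne_top (by simp) hBt
  have h2B0 : 2 * B ≠ 0 := mul_ne_zero (by simp) hB0
  refine ⟨(2 * B).toNNReal, ?_, ?_⟩
  · rw [← ENNReal.coe_le_coe, ENNReal.coe_toNNReal h2Bt]
    calc ((1 : NNReal) : ℝ≥0∞) = 1 * 1 := by simp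
      _ ≤ 2 * B := mul_le_mul' (by norm_num) hB1
  intro w σ hap h hh hh0 hht
  rw [ENNReal.coe_toNNReal h2Bt]
  set c := (2 * B)⁻¹ with hc
  set g := rdf c h with hg
  have hgm : ∀ k, Measurable (g k) := rdf_meas c hh
  let μ := volume.withDensity w
  have hwint : ∀ f : (Fin d → ℝ) → ℝ≥0∞, Measurable f →
      ∫⁻ x, f x ^ p ∂μ = ∫⁻ x, f x ^ p * w x := fun f hf => wd_int hap.mw (hf.pow_const _)
  set n0 := (∫⁻ x, h x ^ p * w x) ^ (1 / p) with hn0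
  have hstep : ∀ k, (∫⁻ x, g k x ^ p ∂μ) ^ (1 / p) ≤ 2⁻¹ ^ k * n0 := by
    intro k
    induction k with
    | zero => rw [hwint _ (hgm 0)]; simp [hg, rdf, hn0]
    | succ k ih =>
      have e : ∀ x, g (k + 1) x ^ p = c ^ p * mxf volume (g k) x ^ p := fun x => by
        simp only [hg, rdf]; rw [ENNReal.mul_rpow_of_nonneg _ _ (by linarith)]
      have hmm := mxf_measurable volume (g k)
      simp_rw [e]
      rw [lintegral_const_mul _ (hmm.pow_const _), hwint _ hmm,
        ENNReal.mul_rpow_of_nonneg _ _ (by positivity), ← ENNReal.rpow_mul,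
        mul_one_div_cancel (by linarith), ENNReal.rpow_one]
      calc _ ≤ c * (C * ∫⁻ x, g k x ^ p * w x) ^ (1 / p) := by
            gcongr; exact hM w σ hap _ (hgm k)
        _ = c * (C ^ (1 / p) * (∫⁻ x, g k x ^ p ∂μ) ^ (1 / p)) := by
            rw [ENNReal.mul_rpow_of_nonneg _ _ (by positivity), hwint _ (hgm k)]
        _ ≤ c * (B * (2⁻¹ ^ k * n0)) := by
            gcongr; exact le_max_right _ _
        _ = (c * B) * (2⁻¹ ^ k * n0) := by ring
        _ = 2⁻¹ * (2⁻¹ ^ k * n0) := by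
            congr 1
            rw [hc, ENNReal.mul_inv (by simp) (by simp), mul_assoc,
              ENNReal.inv_mul_cancel hB0 hBt, mul_one]
        _ = _ := by ring
  have hsum : ∀ m, (∫⁻ x, (∑ k ∈ Finset.range m, g k x) ^ p ∂μ) ^ (1 / p) ≤
      ∑ k ∈ Finset.range m, 2⁻¹ ^ k * n0 := by
    intro m
    induction m with
    | zero => simp [show 0 < p by linarith]
    | succ m ih =>
      simp_rw [Finset.sum_range_succ]
      refine le_trans (ENNReal.lintegral_Lp_add_le (f := fun x => ∑ k ∈ Finset.range m, g k x)
        (g := g m) (Finset.measurable_fun_sum _ fun k _ => hgm k).aemeasurable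
        (hgm m).aemeasurable hp.le) ?_
      exact add_le_add ih (hstep m)
  have hsum2 : ∀ m, ∑ k ∈ Finset.range m, (2⁻¹ : ℝ≥0∞) ^ k * n0 ≤ 2 * n0 := by
    intro m
    rw [← Finset.sum_mul]
    gcongr
    refine (ENNReal.sum_le_tsum _).trans ?_
    rw [ENNReal.tsum_geometric, ENNReal.one_sub_inv_two, inv_inv]
  set H0 : (Fin d → ℝ) → ℝ≥0∞ := fun x => ∑' k, g k x with hH0
  have hH0m : Measurable H0 := Measurable.tsum hgm
  have hH0n : ∫⁻ x, H0 x ^ p ∂μ ≤ (2 * n0) ^ p := by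
    have hlim : Filter.Tendsto (fun m => ∫⁻ x, (∑ k ∈ Finset.range m, g k x) ^ p ∂μ)
        Filter.atTop (nhds (∫⁻ x, H0 x ^ p ∂μ)) := by
      refine lintegral_tendsto_of_tendsto_of_monotone
        (fun m => ((Finset.measurable_fun_sum _ fun k _ => hgm k).pow_const _).aemeasurable)
        (Filter.Eventually.of_forall fun x => ?_) (Filter.Eventually.of_forall fun x => ?_)
      · intro a b hab
        exact ENNReal.rpow_le_rpow (Finset.sum_le_sum_of_subset (Finset.range_mono hab))
          (by linarith)
      · exact (ENNReal.continuous_rpow_const.tendsto _).comp (ENNReal.tendsto_nat_tsum _)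
    refine le_of_tendsto' hlim fun m => ?_
    rw [← ENNReal.rpow_inv_le_iff (by linarith), ← one_div]
    exact (hsum m).trans (hsum2 m)
  rw [hwint _ hH0m] at hH0n
  have hn0t : n0 ≠ ⊤ := ENNReal.rpow_ne_top_of_nonneg (by positivity) hht
  have hfin : ∫⁻ x, H0 x ^ p * w x ≠ ⊤ := ne_top_of_le_ne_top
    (ENNReal.rpow_ne_top_of_nonneg (by linarith) (ENNReal.mul_ne_top (by simp) hn0t)) hH0n
  have hae : ∀ᵐ x, H0 x ≠ ⊤ := by
    filter_upwards [ae_lt_top ((hH0m.pow_const _).mul hap.mw) hfin] with x hx htop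
    have hx' : H0 x ^ p * w x < ⊤ := hx
    rw [htop, ENNReal.top_rpow_of_pos (by linarith), ENNReal.top_mul (hap.w0 x)] at hx'
    exact lt_irrefl _ hx'
  have hmax : ∀ x, mxf volume H0 x ≤ 2 * B * H0 x := by
    intro x
    calc mxf volume H0 x ≤ ∑' k, mxf volume (g k) x := mxf_tsum_le g hgm x
      _ = ∑' k, 2 * B * g (k + 1) x := by
          refine tsum_congr fun k => ?_
          simp only [hg, rdf]
          rw [← mul_assoc, hc, ENNReal.mul_inv_cancel h2B0 h2Bt, one_mul]
      _ = 2 * B * ∑' k, g (k + 1) x := ENNReal.tsum_mul_left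
      _ ≤ 2 * B * H0 x := by
          gcongr
          exact ENNReal.tsum_comp_le_tsum_of_injective (add_left_injective 1) (fun k => g k x)
  have hpos : ∀ x, H0 x ≠ 0 := by
    intro x hx
    have h1 : g 1 x ≤ 0 := hx ▸ ENNReal.le_tsum 1
    simp only [hg, rdf, nonpos_iff_eq_zero, mul_eq_zero] at h1
    rcases h1 with h1 | h1
    · exact h2Bt (ENNReal.inv_eq_zero.1 h1)
    · exact mxf_pos hh0 x h1
  set H : (Fin d → ℝ) → ℝ≥0∞ := {x | H0 x = ⊤}.piecewise (fun _ => 1) H0 with hH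
  have hms : MeasurableSet {x | H0 x = ⊤} := hH0m (measurableSet_singleton _)
  have hHe : H =ᵐ[volume] H0 := by
    filter_upwards [hae] with x hx
    rw [hH, piecewise_eq_of_notMem _ _ _ (show x ∉ {x | H0 x = ⊤} from hx)]
  refine ⟨H, ⟨Measurable.piecewise hms measurable_const hH0m, ?_, ?_, ?_⟩, ?_, ?_⟩
  · intro x
    by_cases hx : H0 x = ⊤
    · rw [hH, piecewise_eq_of_mem _ _ _ (show x ∈ {x | H0 x = ⊤} from hx)]; simp
    · rw [hH, piecewise_eq_of_notMem _ _ _ (show x ∉ {x | H0 x = ⊤} from hx)]; exact hpos x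
  · intro x
    by_cases hx : H0 x = ⊤
    · rw [hH, piecewise_eq_of_mem _ _ _ (show x ∈ {x | H0 x = ⊤} from hx)]; simp
    · rw [hH, piecewise_eq_of_notMem _ _ _ (show x ∉ {x | H0 x = ⊤} from hx)]; exact hx
  · intro z r
    filter_upwards [hHe] with y hy hyb
    have h1 := (le_mxf volume H hyb).trans ((mxf_congr_int hHe y).le.trans (hmax y))
    rw [← hy, ENNReal.div_le_iff (vol_ball_ne_zero _ (Metric.pos_of_mem_ball hyb))
      (vol_ball_ne_top _ _)] at h1
    calc _ ≤ _ := h1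
      _ = _ := by ring
  · filter_upwards [hHe] with x hx
    rw [hx]
    exact ENNReal.le_tsum (f := fun k => g k x) 0
  · have : ∫⁻ x, H x ^ p * w x = ∫⁻ x, H0 x ^ p * w x := by
      refine lintegral_congr_ae ?_
      filter_upwards [hHe] with x hx
      rw [hx]
    rw [this, one_div, ENNReal.rpow_inv_le_iff (by linarith)]
    exact hH0n

lemma dual_le {α : Type*} [MeasurableSpace α] (μ : Measure α) [SigmaFinite μ] {p q : ℝ}
    (hpq : p.HolderConjugate q) {f : α → ℝ≥0∞} (hf : Measurable f) (C : ℝ≥0∞)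
    (h : ∀ φ : α → ℝ≥0∞, Measurable φ → ∫⁻ x, φ x ^ q ∂μ ≠ ⊤ →
      ∫⁻ x, f x * φ x ∂μ ≤ C * (∫⁻ x, φ x ^ q ∂μ) ^ (1 / q)) :
    ∫⁻ x, f x ^ p ∂μ ≤ C ^ p := by
  have hp := hpq.lt
  have hq := hpq.symm.lt
  have hpq' := hpq.mul_eq_add
  set S := spanningSets μ with hS
  have hSm : ∀ k, MeasurableSet (S k) := measurableSet_spanningSets μ
  let fk : ℕ → α → ℝ≥0∞ := fun k => (S k).indicator (fun x => min (f x) k)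
  have hfkm : ∀ k, Measurable (fk k) := fun k =>
    (hf.min measurable_const).indicator (hSm k)
  have hle : ∀ k x, fk k x ≤ f x := fun k x =>
    (indicator_le_self' (fun _ _ => zero_le) x).trans (min_le_left _ _)
  have hlim : Filter.Tendsto (fun k => ∫⁻ x, fk k x ^ p ∂μ) Filter.atTop
      (nhds (∫⁻ x, f x ^ p ∂μ)) := by
    refine lintegral_tendsto_of_tendsto_of_monotone
      (fun k => ((hfkm k).pow_const _).aemeasurable)
      (Filter.Eventually.of_forall fun x => ?_) (Filter.Eventually.of_forall fun x => ?_)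
    · intro a b hab
      refine ENNReal.rpow_le_rpow ?_ (by linarith)
      have h1 : S a ⊆ S b := monotone_spanningSets μ hab
      by_cases hx : x ∈ S a
      · simp only [fk, indicator_of_mem hx, indicator_of_mem (h1 hx)]
        exact min_le_min le_rfl (by exact_mod_cast hab)
      · simp only [fk, indicator_of_notMem hx]; exact zero_le
    · refine (ENNReal.continuous_rpow_const.tendsto _).comp ?_
      have h1 : Filter.Tendsto (fun k : ℕ => min (f x) (k : ℝ≥0∞)) Filter.atTop (nhds (f x)) := by
        have := (tendsto_const_nhds (x := f x)).min ENNReal.tendsto_nat_nhds_top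
        simpa using this
      refine h1.congr' ?_
      have hx : x ∈ ⋃ k, S k := by rw [hS, iUnion_spanningSets]; trivial
      obtain ⟨m, hm⟩ := mem_iUnion.1 hx
      filter_upwards [Filter.eventually_ge_atTop m] with k hk
      simp only [fk]
      rw [indicator_of_mem (monotone_spanningSets μ hk hm)]
  refine le_of_tendsto' hlim fun k => ?_
  set I := ∫⁻ x, fk k x ^ p ∂μ with hI
  have hIt : I ≠ ⊤ := by
    have : I ≤ ∫⁻ x, (S k).indicator (fun _ => (k : ℝ≥0∞) ^ p) x ∂μ := by
      refine lintegral_mono fun x => ?_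
      by_cases hx : x ∈ S k
      · simp only [fk, indicator_of_mem hx]
        exact ENNReal.rpow_le_rpow (min_le_right _ _) (by linarith)
      · simp [fk, indicator_of_notMem hx, show 0 < p by linarith]
    refine ne_top_of_le_ne_top ?_ this
    rw [lintegral_indicator (hSm k), setLIntegral_const]
    exact ENNReal.mul_ne_top (ENNReal.rpow_ne_top_of_nonneg (by linarith) (by simp))
      (measure_spanningSets_lt_top μ k).ne
  have e1 : ∀ x, (fk k x ^ (p - 1)) ^ q = fk k x ^ p := fun x => by
    rw [← ENNReal.rpow_mul]; congr 1; linarith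
  have h1 := h (fun x => fk k x ^ (p - 1)) ((hfkm k).pow_const _) (by simp_rw [e1]; exact hIt)
  simp_rw [e1] at h1
  have h2 : I ≤ C * I ^ (1 / q) := by
    refine le_trans (lintegral_mono fun x => ?_) h1
    calc fk k x ^ p = fk k x ^ (1 : ℝ) * fk k x ^ (p - 1) := by
          rw [← ENNReal.rpow_add_of_nonneg _ _ (by norm_num) (by linarith)]; congr 1; ring
      _ ≤ _ := by rw [ENNReal.rpow_one]; gcongr; exact hle k x
  by_cases hI0 : I = 0
  · rw [hI0]; exact zero_le
  have h3 : I = I ^ (1 / p) * I ^ (1 / q) := by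
    rw [← ENNReal.rpow_add _ _ hI0 hIt]
    have : 1 / p + 1 / q = 1 := by simpa using hpq.inv_add_inv_eq_one
    rw [this, ENNReal.rpow_one]
  have h4 : I ^ (1 / p) ≤ C := by
    refine (ENNReal.mul_le_mul_iff_left ?_ ?_).1 (h3.symm.le.trans h2)
    · simp [ENNReal.rpow_eq_zero_iff, hI0, hIt]
    · exact ENNReal.rpow_ne_top_of_nonneg (by positivity) hIt
  rwa [one_div, ENNReal.rpow_inv_le_iff (by linarith)] at h4

lemma A1w.mono {d : ℕ} {K L : ℝ≥0∞} (hKL : K ≤ L) {u : (Fin d → ℝ) → ℝ≥0∞} (h : A1w K u) :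
    A1w L u where
  meas := h.meas
  ne0 := h.ne0
  net := h.net
  avg := fun c r => by
    filter_upwards [h.avg c r] with y hy hyb
    exact (hy hyb).trans (by gcongr)

/-- The weighted hypothesis for products of `A₁` weights. -/
def Hyp (d : ℕ) (p0 : ℝ) (Nf : NNReal → NNReal) (f g : (Fin d → ℝ) → ℝ≥0∞) : Prop :=
  ∀ K : NNReal, 1 ≤ K → ∀ u v : (Fin d → ℝ) → ℝ≥0∞, A1w K u → A1w K v →
    ∫⁻ x, f x ^ p0 * fw p0 u v x ≤ Nf K * ∫⁻ x, g x ^ p0 * fw p0 u v x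

lemma fw_ne0 {d : ℕ} (p : ℝ) {K : ℝ≥0∞} {u v : (Fin d → ℝ) → ℝ≥0∞} (hu : A1w K u) (hv : A1w K v)
    (x : Fin d → ℝ) : fw p u v x ≠ 0 := by
  simp [fw, ENNReal.rpow_eq_zero_iff, hu.ne0, hv.net, hv.ne0]

/-- Key estimate: from the `p0` weighted inequality with `U V^{1-p0}`. -/
lemma key_step {d : ℕ} {p0 : ℝ} (hp0 : 1 ≤ p0) {f g U V : (Fin d → ℝ) → ℝ≥0∞} {K N : ℝ≥0∞}
    (hf : Measurable f) (hU : A1w K U) (hV : A1w K V)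
    (hH : ∫⁻ x, f x ^ p0 * fw p0 U V x ≤ N * ∫⁻ x, g x ^ p0 * fw p0 U V x)
    (hgV : ∀ᵐ x, g x ≤ V x) :
    ∫⁻ x, f x * U x ≤ N ^ (1 / p0) * ∫⁻ x, V x * U x := by
  have ha : 0 ≤ 1 / p0 := by positivity
  have ha1 : 0 ≤ 1 - 1 / p0 := by
    rw [sub_nonneg, div_le_one (by linarith)]; exact hp0
  have hp00 : p0 ≠ 0 := by linarith
  have e : ∀ x, f x * U x =
      (f x ^ p0 * fw p0 U V x) ^ (1 / p0) * (V x * U x) ^ (1 - 1 / p0) := by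
    intro x
    unfold fw
    rw [ENNReal.mul_rpow_of_nonneg _ _ ha, ENNReal.mul_rpow_of_nonneg _ _ ha,
      ENNReal.mul_rpow_of_nonneg _ _ ha1, ← ENNReal.rpow_mul, ← ENNReal.rpow_mul,
      mul_one_div_cancel hp00, ENNReal.rpow_one]
    have e1 : V x ^ ((1 - p0) * (1 / p0)) * V x ^ (1 - 1 / p0) = 1 := by
      rw [← ENNReal.rpow_add _ _ (hV.ne0 x) (hV.net x)]
      convert ENNReal.rpow_zero using 2
      field_simp; ring
    have e2 : U x ^ (1 / p0) * U x ^ (1 - 1 / p0) = U x := by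
      rw [← ENNReal.rpow_add _ _ (hU.ne0 x) (hU.net x)]
      simp
    calc f x * U x = f x * (U x ^ (1 / p0) * U x ^ (1 - 1 / p0)) *
        (V x ^ ((1 - p0) * (1 / p0)) * V x ^ (1 - 1 / p0)) := by rw [e1, e2, mul_one]
      _ = _ := by ring
  have hg : ∫⁻ x, g x ^ p0 * fw p0 U V x ≤ ∫⁻ x, V x * U x := by
    refine lintegral_mono_ae ?_
    filter_upwards [hgV] with x hx
    unfold fw
    calc g x ^ p0 * (U x * V x ^ (1 - p0)) ≤ V x ^ p0 * (U x * V x ^ (1 - p0)) := by gcongr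
      _ = (V x ^ p0 * V x ^ (1 - p0)) * U x := by ring
      _ = V x * U x := by
        rw [← ENNReal.rpow_add _ _ (hV.ne0 x) (hV.net x)]; simp
  simp_rw [e]
  calc _ ≤ (∫⁻ x, f x ^ p0 * fw p0 U V x) ^ (1 / p0) * (∫⁻ x, V x * U x) ^ (1 - 1 / p0) :=
        ENNReal.lintegral_mul_norm_pow_le
          ((hf.pow_const _).mul (fw_meas _ hU.meas hV.meas)).aemeasurable
          (hV.meas.mul hU.meas).aemeasurable ha ha1 (by ring)
    _ ≤ (N * ∫⁻ x, V x * U x) ^ (1 / p0) * (∫⁻ x, V x * U x) ^ (1 - 1 / p0) := by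
        gcongr
        exact hH.trans (by gcongr)
    _ = N ^ (1 / p0) * ((∫⁻ x, V x * U x) ^ (1 / p0) * (∫⁻ x, V x * U x) ^ (1 - 1 / p0)) := by
        rw [ENNReal.mul_rpow_of_nonneg _ _ ha]; ring
    _ = _ := by
        rw [← ENNReal.rpow_add_of_nonneg _ _ ha ha1]; simp

lemma extrap_one (d : ℕ) {p0 p : ℝ} (hp0 : 1 ≤ p0) (hp : 1 < p) (Nf : NNReal → NNReal)
    (K : NNReal) (hK : 1 ≤ K) :
    ∃ N' : NNReal, ∀ f g : (Fin d → ℝ) → ℝ≥0∞, Measurable f → Measurable g → Hyp d p0 Nf f g →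
      ∀ u v : (Fin d → ℝ) → ℝ≥0∞, A1w K u → A1w K v →
        ∫⁻ x, f x ^ p * fw p u v x ≤ N' * ∫⁻ x, g x ^ p * fw p u v x := by
  have hpq : p.HolderConjugate (p.conjExponent) := Real.HolderConjugate.conjExponent hp
  set q := p.conjExponent
  have hq := hpq.symm.lt
  have hKt : (K : ℝ≥0∞) ^ p ≠ ⊤ := ENNReal.rpow_ne_top_of_nonneg (by linarith) (by simp)
  have hK0 : (K : ℝ≥0∞) ≠ 0 := by
    have : K ≠ 0 := (zero_lt_one.trans_le hK).ne'
    exact_mod_cast this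
  obtain ⟨K1, hK1, h1⟩ := rdf_thm (d := d) hpq hKt
  obtain ⟨K2, hK2, h2⟩ := rdf_thm (d := d) hpq.symm
    (ENNReal.rpow_ne_top_of_nonneg (by linarith : 0 ≤ q - 1) hKt)
  set L := max K1 K2 with hL
  set M : NNReal := max 1 (Nf L) with hM
  set C : NNReal := 4 * M ^ (1 / p0) with hC
  have hM0 : M ≠ 0 := (zero_lt_one.trans_le (le_max_left _ _)).ne'
  have hC0 : C ≠ 0 := by
    rw [hC]; exact mul_ne_zero (by norm_num) (by simp [NNReal.rpow_eq_zero_iff, hM0])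
  refine ⟨C ^ p, fun f g hf hg hH u v hu hv => ?_⟩
  have hap := ApP_of_A1 hpq hK0 (by simp) hu hv
  set w := fw p u v with hw
  set σ := fw q v u with hσ
  by_cases hgt : ∫⁻ x, g x ^ p * w x = ⊤
  · rw [hgt, ENNReal.mul_top]
    · exact le_top
    · simp [NNReal.rpow_eq_zero_iff, hC0]
  by_cases hg0 : ∫⁻ x, g x = 0
  · have hmm : ∀ (f : (Fin d → ℝ) → ℝ≥0∞) (s : ℝ), Measurable f →
        Measurable fun x => f x ^ s * fw s u v x := fun f s hf =>
      (hf.pow_const _).mul (fw_meas _ hu.meas hv.meas)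
    have hgz : g =ᵐ[volume] 0 := (lintegral_eq_zero_iff hg).1 hg0
    have hz := hH K hK u v hu hv
    have : ∫⁻ x, g x ^ p0 * fw p0 u v x = 0 := by
      rw [lintegral_eq_zero_iff (hmm g p0 hg)]
      filter_upwards [hgz] with x hx
      simp [hx, show 0 < p0 by linarith]
    rw [this, mul_zero, nonpos_iff_eq_zero,
      lintegral_eq_zero_iff (hmm f p0 hf)] at hz
    have : ∫⁻ x, f x ^ p * w x = 0 := by
      rw [lintegral_eq_zero_iff (hmm f p hf)]
      filter_upwards [hz] with x hx
      have hx' : f x ^ p0 * fw p0 u v x = 0 := hx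
      rw [mul_eq_zero, or_iff_left (fw_ne0 _ hu hv x), ENNReal.rpow_eq_zero_iff] at hx'
      have hfx : f x = 0 := by
        rcases hx' with h | h
        · exact h.1
        · linarith [h.2]
      simp [hfx, show 0 < p by linarith]
    rw [this]; exact zero_le
  obtain ⟨V, hV, hgV, hVn⟩ := h1 w σ hap g hg hg0 hgt
  have hpinv : 1 / p + 1 / q = 1 := by simpa using hpq.inv_add_inv_eq_one
  have hqp : q / p = q - 1 := by
    have := hpq.mul_eq_add
    rw [div_eq_iff (by linarith)]; linarith
  set G := (∫⁻ x, g x ^ p * w x) ^ (1 / p) with hG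
  have hdual := dual_le (volume : Measure (Fin d → ℝ)) hpq
    (f := fun x => f x * w x ^ (1 / p)) (hf.mul (hap.mw.pow_const _)) (C * G) ?_
  · simp_rw [ENNReal.mul_rpow_of_nonneg _ _ (show 0 ≤ p by linarith), ← ENNReal.rpow_mul,
      one_div_mul_cancel (show p ≠ 0 by linarith), ENNReal.rpow_one] at hdual
    rw [hG, ← ENNReal.rpow_mul, one_div_mul_cancel (show p ≠ 0 by linarith),
      ENNReal.rpow_one] at hdual
    rw [ENNReal.coe_rpow_of_nonneg _ (by linarith)]
    exact hdual
  intro ψ hψ hψt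
  have hwp : Measurable fun x => w x ^ (1 / p) := hap.mw.pow_const _
  have hh : Measurable fun x => ψ x * w x ^ (1 / p) := hψ.mul hwp
  by_cases hz : ∫⁻ x, ψ x * w x ^ (1 / p) = 0
  · have : ∫⁻ x, f x * w x ^ (1 / p) * ψ x = 0 := by
      rw [lintegral_eq_zero_iff hh] at hz
      have hm3 : Measurable fun x => f x * w x ^ (1 / p) * ψ x := (hf.mul hwp).mul hψ
      rw [lintegral_eq_zero_iff hm3]
      filter_upwards [hz] with x hx
      have hx' : ψ x * w x ^ (1 / p) = 0 := hx
      show f x * w x ^ (1 / p) * ψ x = 0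
      rw [mul_assoc, mul_comm (w x ^ (1 / p)), hx', mul_zero]
    rw [this]; exact zero_le
  have e1 : ∀ x, (ψ x * w x ^ (1 / p)) ^ q * σ x = ψ x ^ q := by
    intro x
    rw [ENNReal.mul_rpow_of_nonneg _ _ (by linarith), ← ENNReal.rpow_mul, hap.rel x, mul_assoc,
      ← ENNReal.rpow_add _ _ (hap.w0 x) (hap.wt x)]
    rw [show 1 / p * q + (1 - q) = 0 by rw [one_div_mul_eq_div, hqp]; ring]; simp
  obtain ⟨U, hU, hψU, hUn⟩ := h2 σ w (hap.symm hpq) _ hh hz (by simp_rw [e1]; exact hψt)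
  simp_rw [e1] at hUn
  have hU' : A1w (L : ℝ≥0∞) U := hU.mono (by exact_mod_cast le_max_right _ _)
  have hV' : A1w (L : ℝ≥0∞) V := hV.mono (by exact_mod_cast le_max_left _ _)
  have hkey := key_step hp0 hf hU' hV' (hH L (hK1.trans (le_max_left _ _)) U V hU' hV') hgV
  have hhol : ∫⁻ x, V x * U x ≤ (∫⁻ x, V x ^ p * w x) ^ (1 / p) *
      (∫⁻ x, U x ^ q * σ x) ^ (1 / q) := by
    have := ENNReal.lintegral_mul_le_Lp_mul_Lq (volume : Measure (Fin d → ℝ)) hpq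
      (f := fun x => V x * w x ^ (1 / p)) (g := fun x => U x * w x ^ (-(1 / p)))
      (hV.meas.mul hwp).aemeasurable (hU.meas.mul (hap.mw.pow_const _)).aemeasurable
    refine le_trans (le_of_eq ?_) (this.trans (le_of_eq ?_))
    · refine lintegral_congr fun x => ?_
      show _ = V x * w x ^ (1 / p) * (U x * w x ^ (-(1 / p)))
      calc V x * U x = V x * U x * (w x ^ (1 / p) * w x ^ (-(1 / p))) := by
            rw [← ENNReal.rpow_add _ _ (hap.w0 x) (hap.wt x)]; simp
        _ = _ := by ring
    · congr 2
      · refine lintegral_congr fun x => ?_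
        rw [ENNReal.mul_rpow_of_nonneg _ _ (by linarith), ← ENNReal.rpow_mul,
          one_div_mul_cancel (by linarith), ENNReal.rpow_one]
      · refine lintegral_congr fun x => ?_
        rw [ENNReal.mul_rpow_of_nonneg _ _ (by linarith), ← ENNReal.rpow_mul, hap.rel x]
        congr 2
        rw [neg_mul, one_div_mul_eq_div, hqp]; ring
  calc ∫⁻ x, f x * w x ^ (1 / p) * ψ x ≤ ∫⁻ x, f x * U x := by
        refine lintegral_mono_ae ?_
        filter_upwards [hψU] with x hx
        rw [mul_assoc, mul_comm (w x ^ (1 / p))]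
        gcongr
    _ ≤ (Nf L : ℝ≥0∞) ^ (1 / p0) * ∫⁻ x, V x * U x := hkey
    _ ≤ (M : ℝ≥0∞) ^ (1 / p0) * ((2 * G) * (2 * (∫⁻ x, ψ x ^ q) ^ (1 / q))) := by
        gcongr
        · exact_mod_cast le_max_right _ _
        · exact hhol.trans (mul_le_mul' hVn hUn)
    _ = _ := by
        rw [hC, ENNReal.coe_mul, ENNReal.coe_rpow_of_nonneg _ (by positivity)]
        push_cast
        ring

lemma extrap (d : ℕ) {p0 p : ℝ} (hp0 : 1 ≤ p0) (hp : 1 < p) (Nf : NNReal → NNReal) :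
    ∃ Nf' : NNReal → NNReal, ∀ f g : (Fin d → ℝ) → ℝ≥0∞, Measurable f → Measurable g →
      Hyp d p0 Nf f g → Hyp d p Nf' f g := by
  have := fun K : {K : NNReal // 1 ≤ K} => extrap_one d hp0 hp Nf K.1 K.2
  choose N' hN' using this
  refine ⟨fun K => if h : 1 ≤ K then N' ⟨K, h⟩ else 0, fun f g hf hg hH K hK u v hu hv => ?_⟩
  simp only [dif_pos hK]
  exact hN' ⟨K, hK⟩ f g hf hg hH u v hu hv

lemma mixedLnorm_peel (n : ℕ) : ∀ (q : Fin (n + 1) → ℝ) (g : (Fin (n + 1) → ℝ) → ℝ≥0∞),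
    mixedLnorm (n + 1) q g = mixedLnorm n (fun i => q i.succ)
      (fun y => (∫⁻ t : ℝ, g (Fin.cons t y) ^ q 0) ^ (1 / q 0)) := by
  induction n with
  | zero =>
    intro q g
    simp only [mixedLnorm]
    have : ∀ t : ℝ, (Fin.snoc (fun i : Fin 0 => i.elim0) t : Fin 1 → ℝ)
        = Fin.cons t (fun i : Fin 0 => i.elim0) := by
      intro t; funext i; fin_cases i; rfl
    simp only [this]
    rfl
  | succ n ih =>
    intro q g
    have e1 : ∀ (m : ℕ) (q : Fin (m + 1) → ℝ) (g : (Fin (m + 1) → ℝ) → ℝ≥0∞),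
        mixedLnorm (m + 1) q g = (∫⁻ t : ℝ, (mixedLnorm m (fun i => q i.castSucc)
          (fun y => g (Fin.snoc y t))) ^ q (Fin.last m)) ^ (1 / q (Fin.last m)) :=
      fun m q g => rfl
    rw [e1 (n + 1) q g, e1 n]
    simp_rw [ih, Fin.cons_snoc_eq_snoc_cons]
    rfl

lemma mixedLnorm_pow {s : ℝ} (hs : 0 < s) (n : ℕ) : ∀ (q : Fin n → ℝ) (_ : ∀ j, 0 < q j)
    (f : (Fin n → ℝ) → ℝ≥0∞),
    mixedLnorm n (fun j => q j / s) (fun x => f x ^ s) = mixedLnorm n q f ^ s := by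
  induction n with
  | zero => intro q _ f; simp only [mixedLnorm]
  | succ n ih =>
    intro q hq f
    have hl := hq (Fin.last n)
    simp only [mixedLnorm]
    simp_rw [ih (fun i => q i.castSucc) (fun j => hq _)]
    simp_rw [← ENNReal.rpow_mul, mul_div_cancel₀ _ hs.ne']
    congr 1
    field_simp

lemma consM (n : ℕ) : MeasurePreserving
    (fun p : ℝ × (Fin n → ℝ) => (Fin.cons p.1 p.2 : Fin (n + 1) → ℝ)) volume volume := by
  have h := (volume_preserving_piFinSuccAbove (fun _ : Fin (n + 1) => ℝ) 0).symm
  have e : (fun p : ℝ × (Fin n → ℝ) => (Fin.cons p.1 p.2 : Fin (n + 1) → ℝ)) =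
      (MeasurableEquiv.piFinSuccAbove (fun _ : Fin (n + 1) => ℝ) 0).symm := by
    funext p
    simp [MeasurableEquiv.piFinSuccAbove_symm_apply, Fin.insertNthEquiv]
  rw [e]
  exact h

lemma lint_cons {n : ℕ} {F : (Fin (n + 1) → ℝ) → ℝ≥0∞} (hF : Measurable F) :
    ∫⁻ x, F x = ∫⁻ y : Fin n → ℝ, ∫⁻ t : ℝ, F (Fin.cons t y) := by
  rw [← (consM n).lintegral_comp hF, Measure.volume_eq_prod]
  exact lintegral_prod_symm' _ (hF.comp (consM n).measurable)

lemma meas_cons {n : ℕ} {F : (Fin (n + 1) → ℝ) → ℝ≥0∞} (hF : Measurable F) :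
    Measurable fun y : Fin n → ℝ => ∫⁻ t : ℝ, F (Fin.cons t y) :=
  Measurable.lintegral_prod_left' (f := fun p : ℝ × (Fin n → ℝ) => F (Fin.cons p.1 p.2))
    (hF.comp (consM n).measurable)

lemma tail_meas (n : ℕ) : Measurable (fun x : Fin (n + 1) → ℝ => (Fin.tail x : Fin n → ℝ)) :=
  measurable_pi_lambda _ fun _ => measurable_pi_apply _

lemma tail_ae {n : ℕ} {P : (Fin n → ℝ) → Prop} (h : ∀ᵐ y, P y) :
    ∀ᵐ x : Fin (n + 1) → ℝ, P (Fin.tail x) := by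
  have e := (volume_preserving_piFinSuccAbove (fun _ : Fin (n + 1) => ℝ) 0)
  have h2 : ∀ᵐ p : ℝ × (Fin n → ℝ), P p.2 := by
    have := (Measure.quasiMeasurePreserving_snd (μ := (volume : Measure ℝ))
      (ν := (volume : Measure (Fin n → ℝ)))).ae h
    exact this
  exact e.quasiMeasurePreserving.ae h2

lemma cons_mem_ball {n : ℕ} {c : Fin (n + 1) → ℝ} {r : ℝ} (hr : 0 < r) (t : ℝ) (y : Fin n → ℝ) :
    (Fin.cons t y : Fin (n + 1) → ℝ) ∈ Metric.ball c r ↔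
      t ∈ Metric.ball (c 0) r ∧ y ∈ Metric.ball (Fin.tail c) r := by
  simp only [Metric.mem_ball]
  rw [dist_pi_lt_iff hr, dist_pi_lt_iff hr, Fin.forall_fin_succ]
  simp [Fin.tail]

lemma int_tail {n : ℕ} {u : (Fin n → ℝ) → ℝ≥0∞} (hu : Measurable u) (c : Fin (n + 1) → ℝ) {r : ℝ}
    (hr : 0 < r) : ∫⁻ x in Metric.ball c r, u (Fin.tail x) =
      volume (Metric.ball (c 0) r) * ∫⁻ y in Metric.ball (Fin.tail c) r, u y := by
  have hb : MeasurableSet (Metric.ball c r) := Metric.isOpen_ball.measurableSet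
  have hb0 : MeasurableSet (Metric.ball (c 0) r) := Metric.isOpen_ball.measurableSet
  have hbt : MeasurableSet (Metric.ball (Fin.tail c) r : Set (Fin n → ℝ)) :=
    Metric.isOpen_ball.measurableSet
  have hut : Measurable fun x : Fin (n + 1) → ℝ => u (Fin.tail x) := hu.comp (tail_meas n)
  rw [← lintegral_indicator hb, lint_cons (hut.indicator hb),
    ← lintegral_indicator hbt, ← lintegral_const_mul _ (hu.indicator hbt)]
  refine lintegral_congr fun y => ?_
  have : ∀ t : ℝ, (Metric.ball c r).indicator (fun x => u (Fin.tail x)) (Fin.cons t y) =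
      (Metric.ball (c 0) r).indicator
        (fun _ => (Metric.ball (Fin.tail c) r).indicator u y) t := by
    intro t
    classical
    simp only [indicator_apply, cons_mem_ball hr, Fin.tail_cons]
    by_cases h1 : t ∈ Metric.ball (c 0) r <;>
      by_cases h2 : y ∈ Metric.ball (Fin.tail c) r <;> simp [h1, h2]
  simp_rw [this]
  rw [lintegral_indicator hb0, setLIntegral_const, mul_comm]

lemma A1w.tail {n : ℕ} {K : ℝ≥0∞} {u : (Fin n → ℝ) → ℝ≥0∞} (h : A1w K u) :
    A1w K (fun x : Fin (n + 1) → ℝ => u (Fin.tail x)) where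
  meas := h.meas.comp (tail_meas n)
  ne0 := fun x => h.ne0 _
  net := fun x => h.net _
  avg := by
    intro c r
    rcases le_or_gt r 0 with hr | hr
    · simp [Metric.ball_eq_empty.2 hr]
    filter_upwards [tail_ae (h.avg (Fin.tail c) r)] with x hx hxb
    have hv := int_tail (n := n) (u := fun _ => 1) measurable_const c hr
    simp only [setLIntegral_one] at hv
    rw [int_tail h.meas c hr, hv]
    have hx2 : Fin.tail x ∈ Metric.ball (Fin.tail c) r := by
      rw [← Fin.cons_self_tail x] at hxb
      exact ((cons_mem_ball hr _ _).1 hxb).2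
    calc _ ≤ volume (Metric.ball (c 0) r) *
          (K * volume (Metric.ball (Fin.tail c) r) * u (Fin.tail x)) := by
          gcongr; exact hx hx2
      _ = _ := by ring

lemma A1w_one : A1w (d := 0) 1 (fun _ => 1) where
  meas := measurable_const
  ne0 := by simp
  net := by simp
  avg := by intro c r; simp

lemma main_ind (n : ℕ) : ∀ (p0 : ℝ), 1 ≤ p0 → ∀ (q : Fin n → ℝ), (∀ j, 1 < q j) →
    ∀ Nf : NNReal → NNReal, ∃ C : NNReal, ∀ f g : (Fin n → ℝ) → ℝ≥0∞, Measurable f → Measurable g →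
      Hyp n p0 Nf f g → mixedLnorm n q f ≤ C * mixedLnorm n q g := by
  induction n with
  | zero =>
    intro p0 hp0 q _ Nf
    refine ⟨Nf 1 ^ (1 / p0), fun f g hf hg hH => ?_⟩
    have := hH 1 le_rfl _ _ A1w_one A1w_one
    simp only [fw, ENNReal.one_rpow, mul_one] at this
    rw [Measure.volume_pi_eq_dirac (fun i : Fin 0 => i.elim0), lintegral_dirac, lintegral_dirac] at this
    simp only [mixedLnorm]
    have h2 := ENNReal.rpow_le_rpow this (show 0 ≤ 1 / p0 by positivity)
    rw [ENNReal.mul_rpow_of_nonneg _ _ (by positivity), ← ENNReal.rpow_mul, ← ENNReal.rpow_mul,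
      mul_one_div_cancel (by linarith), ENNReal.rpow_one, ENNReal.rpow_one] at h2
    rw [ENNReal.coe_rpow_of_nonneg _ (by positivity)]
    exact h2
  | succ n ih =>
    intro p0 hp0 q hq Nf
    have hq0 := hq 0
    obtain ⟨Nf', hN⟩ := extrap (n + 1) hp0 hq0 Nf
    obtain ⟨C, hC⟩ := ih (q 0) hq0.le (fun i => q i.succ) (fun j => hq _) Nf'
    refine ⟨C, fun f g hf hg hH => ?_⟩
    rw [mixedLnorm_peel, mixedLnorm_peel]
    have hm : ∀ f : (Fin (n + 1) → ℝ) → ℝ≥0∞, Measurable f → Measurable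
        fun y : Fin n → ℝ => (∫⁻ t : ℝ, f (Fin.cons t y) ^ q 0) ^ (1 / q 0) := fun f hf =>
      (meas_cons (hf.pow_const (q 0))).pow_const _
    refine hC _ _ (hm f hf) (hm g hg) ?_
    intro K hK u v hu hv
    have h1 := hN f g hf hg hH K hK _ _ hu.tail hv.tail
    have key : ∀ f : (Fin (n + 1) → ℝ) → ℝ≥0∞, Measurable f →
        ∫⁻ y : Fin n → ℝ, ((∫⁻ t : ℝ, f (Fin.cons t y) ^ q 0) ^ (1 / q 0)) ^ q 0 * fw (q 0) u v y =
        ∫⁻ x, f x ^ q 0 * fw (q 0) (fun x => u (Fin.tail x)) (fun x => v (Fin.tail x)) x := by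
      intro f hf
      have hm2 : Measurable fun x => f x ^ q 0 *
          fw (q 0) (fun x => u (Fin.tail x)) (fun x => v (Fin.tail x)) x :=
        (hf.pow_const _).mul (fw_meas _ hu.tail.meas hv.tail.meas)
      rw [lint_cons hm2]
      refine lintegral_congr fun y => ?_
      rw [← ENNReal.rpow_mul, one_div_mul_cancel (by linarith), ENNReal.rpow_one]
      simp only [fw, Fin.tail_cons]
      have hm3 : Measurable fun t : ℝ => f (Fin.cons t y) ^ q 0 :=
        (hf.comp ((consM n).measurable.comp measurable_prodMk_right)).pow_const _
      rw [lintegral_mul_const _ hm3]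
    rw [key f hf, key g hg]
    exact h1

lemma eball_meas (n : ℕ) (x : Fin n → ℝ) (r : ℝ) : MeasurableSet (eball n x r) := by
  have : Continuous fun y => eudist n x y := by unfold eudist; fun_prop
  exact (isOpen_lt this continuous_const).measurableSet

lemma eball_sub (n : ℕ) (x : Fin n → ℝ) {r : ℝ} (hr : 0 < r) :
    eball n x r ⊆ Metric.ball x r := by
  intro y hy
  rw [Metric.mem_ball, dist_comm, dist_pi_lt_iff hr]
  intro i
  refine lt_of_le_of_lt ?_ (show eudist n x y < r from hy)
  rw [Real.dist_eq, eudist]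
  apply Real.abs_le_sqrt
  exact Finset.single_le_sum (f := fun i => (x i - y i) ^ 2) (fun i _ => sq_nonneg _)
    (Finset.mem_univ i)

lemma sub_eball {n : ℕ} (hn : 0 < n) (x : Fin n → ℝ) {r : ℝ} (hr : 0 < r) :
    Metric.ball x (r / n) ⊆ eball n x r := by
  intro y hy
  have hn' : (1 : ℝ) ≤ n := by exact_mod_cast hn
  have hn0 : (0 : ℝ) < n := by linarith
  have hrn : 0 < r / n := by positivity
  rw [Metric.mem_ball, dist_comm, dist_pi_lt_iff hrn] at hy
  show eudist n x y < r
  rw [eudist, Real.sqrt_lt' hr]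
  calc ∑ i, (x i - y i) ^ 2 < ∑ i : Fin n, (r / n) ^ 2 := by
        have : Nonempty (Fin n) := ⟨⟨0, hn⟩⟩
        refine Finset.sum_lt_sum_of_nonempty Finset.univ_nonempty fun i _ => ?_
        have := hy i
        rw [Real.dist_eq] at this
        rw [sq_lt_sq, abs_of_pos hrn]; exact this
    _ = r ^ 2 / n := by
        simp; field_simp
    _ ≤ r ^ 2 := div_le_self (by positivity) hn'

lemma vol_le_eball {n : ℕ} (hn : 0 < n) (x : Fin n → ℝ) {r : ℝ} (hr : 0 < r) :
    volume (Metric.ball x r) ≤ (n : ℝ≥0∞) ^ n * volume (eball n x r) := by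
  have hn0 : (0 : ℝ) < n := by exact_mod_cast hn
  calc volume (Metric.ball x r) = (n : ℝ≥0∞) ^ n * volume (Metric.ball x (r / n)) := by
        rw [Real.volume_pi_ball _ hr, Real.volume_pi_ball _ (by positivity), Fintype.card_fin,
          ← ENNReal.ofReal_natCast, ← ENNReal.ofReal_pow hn0.le,
          ← ENNReal.ofReal_mul (by positivity), ← mul_pow]
        congr 2
        field_simp
    _ ≤ _ := by gcongr; exact sub_eball hn x hr

lemma A1w.isA1 {n : ℕ} (hn : 0 < n) {K : NNReal} {u : (Fin n → ℝ) → ℝ≥0∞} (h : A1w K u) :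
    IsA1Weight n (fun x => (u x).toReal) (max 1 ((n : ℝ) ^ n * K)) := by
  refine ⟨fun x => ENNReal.toReal_pos (h.ne0 x) (h.net x), ?_, ?_⟩
  · intro x
    refine ⟨Metric.ball x 1, Metric.ball_mem_nhds x one_pos, ?_⟩
    exact integrable_toReal_of_lintegral_ne_top h.meas.aemeasurable
      (h.int_ne_top (by simp) x 1)
  · intro x r hr
    rw [ae_restrict_iff' (eball_meas n x r)]
    filter_upwards [h.avg x r] with y hy hyb
    have h1 := hy (eball_sub n x hr hyb)
    have hBt : volume (eball n x r) ≠ ⊤ :=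
      ne_top_of_le_ne_top (vol_ball_ne_top x r) (measure_mono (eball_sub n x hr))
    have hB0 : volume (eball n x r) ≠ 0 := by
      have hn0 : (0 : ℝ) < n := by exact_mod_cast hn
      exact ((vol_ball_ne_zero x (show 0 < r / n by positivity)).bot_lt.trans_le
        (measure_mono (sub_eball hn x hr))).ne'
    have h2 : ∫⁻ z in eball n x r, u z ≤ (n : ℝ≥0∞) ^ n * K * u y * volume (eball n x r) := by
      calc _ ≤ ∫⁻ z in Metric.ball x r, u z := lintegral_mono_set (eball_sub n x hr)
        _ ≤ K * volume (Metric.ball x r) * u y := h1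
        _ ≤ K * ((n : ℝ≥0∞) ^ n * volume (eball n x r)) * u y := by
            gcongr; exact vol_le_eball hn x hr
        _ = _ := by ring
    have ht : (n : ℝ≥0∞) ^ n * K * u y * volume (eball n x r) ≠ ⊤ :=
      ENNReal.mul_ne_top (ENNReal.mul_ne_top (ENNReal.mul_ne_top (by simp) (by simp)) (h.net y)) hBt
    have h3 := ENNReal.toReal_mono ht h2
    simp only [ENNReal.toReal_mul, ENNReal.toReal_pow, ENNReal.toReal_natCast,
      ENNReal.coe_toReal] at h3
    rw [integral_toReal h.meas.aemeasurable
      (Filter.Eventually.of_forall fun z => (h.net z).lt_top)]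
    have hBp : 0 < (volume (eball n x r)).toReal := ENNReal.toReal_pos hB0 hBt
    rw [inv_mul_le_iff₀ hBp]
    calc _ ≤ _ := h3
      _ = (volume (eball n x r)).toReal * (((n : ℝ) ^ n * K) * (u y).toReal) := by ring
      _ ≤ _ := by gcongr; exact le_max_right _ _

theorem stmt13 (n : ℕ) (hn : 0 < n) (q₀ : ℝ) (hq₀ : 0 < q₀)
    (q : Fin n → ℝ) (hq : ∀ j, q₀ < q j)
    (F : Set (((Fin n → ℝ) → ℝ≥0∞) × ((Fin n → ℝ) → ℝ≥0∞)))
    (hFmeas : ∀ p ∈ F, Measurable p.1 ∧ Measurable p.2)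
    (N : ℝ → ℝ) (hNpos : ∀ c, 1 ≤ c → 0 < N c)
    (hNmono : ∀ c d, 1 ≤ c → c ≤ d → N c ≤ N d)
    (hHyp : ∀ (w : (Fin n → ℝ) → ℝ) (c : ℝ), 1 ≤ c → IsA1Weight n w c →
      ∀ p ∈ F,
        (∫⁻ x, p.1 x ^ q₀ * ENNReal.ofReal (w x))
          ≤ ENNReal.ofReal (N c) * ∫⁻ x, p.2 x ^ q₀ * ENNReal.ofReal (w x)) :
    ∃ C : ℝ, 0 < C ∧ ∀ p ∈ F, mixedLnorm n q p.1 ≠ ⊤ →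
      mixedLnorm n q p.1 ≤ ENNReal.ofReal C * mixedLnorm n q p.2 := by
  obtain ⟨C, hC⟩ := main_ind n 1 le_rfl (fun j => q j / q₀)
    (fun j => by rw [one_lt_div hq₀]; exact hq j)
    (fun K => (N (max 1 ((n : ℝ) ^ n * K))).toNNReal)
  refine ⟨(C ^ (1 / q₀) : NNReal) + 1, by positivity, fun p hp _ => ?_⟩
  obtain ⟨hf, hg⟩ := hFmeas p hp
  have h1 := hC (fun x => p.1 x ^ q₀) (fun x => p.2 x ^ q₀) (hf.pow_const _) (hg.pow_const _) ?_
  · rw [mixedLnorm_pow hq₀ n q (fun j => hq₀.trans (hq j)),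
      mixedLnorm_pow hq₀ n q (fun j => hq₀.trans (hq j))] at h1
    have h2 := ENNReal.rpow_le_rpow h1 (show 0 ≤ 1 / q₀ by positivity)
    rw [ENNReal.mul_rpow_of_nonneg _ _ (by positivity), ← ENNReal.rpow_mul, ← ENNReal.rpow_mul,
      mul_one_div_cancel hq₀.ne', ENNReal.rpow_one, ENNReal.rpow_one,
      ← ENNReal.coe_rpow_of_nonneg _ (by positivity)] at h2
    refine h2.trans ?_
    gcongr
    rw [← ENNReal.ofReal_coe_nnreal]
    exact ENNReal.ofReal_le_ofReal (by linarith)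
  · intro K hK u v hu hv
    have h := hHyp _ _ (le_max_left _ _) (hu.isA1 hn) p hp
    simp only [ENNReal.ofReal_toReal (hu.net _)] at h
    simp only [fw, sub_self, ENNReal.rpow_zero, mul_one, ENNReal.rpow_one]
    exact h
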